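/- arXiv:2102.07184 — 6 statements merged into one kernel-verified Lean document; each statement's English description precedes it below -/
import Mathlib

section
/- Let N be a positive integer, let k₁,…,kₙ be positive integers with k₁ ≥ 2, and let b₁,…,bₙ ∈ {1,2,…,N}. Set K = k₁+⋯+kₙ and define functions f₁,…,f_K on (0,1) as follows: writing the index sequence as k₁−1 copies of the symbol 0, then the symbol b₁, then k₂−1 copies of 0, then b₂, …, then kₙ−1 copies of 0, then bₙ, let f_i(t) = 1/t when the i-th symbol is 0 and f_i(t) = N t^{b−1}/(1−t^N) when the i-th symbol is b ∈ {1,…,N}. Then the iterated integral ∫_{1>t₁>t₂>⋯>t_K>0} f₁(t₁) f₂(t₂) ⋯ f_K(t_K) dt₁⋯dt_K = ζ_N(k₁,…,kₙ; b₁+⋯+bₙ mod N, b₂+⋯+bₙ mod N, …, b_{n−1}+bₙ mod N, bₙ mod N). -/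
open MeasureTheory

/-- The multiple zeta value of level `N`:
`ζ_N(k₁,…,kₙ; a₁,…,aₙ) = N^n Σ_{m₁>⋯>mₙ>0, mᵢ ≡ aᵢ (mod N)} 1/(m₁^{k₁}⋯mₙ^{kₙ})`. -/
noncomputable def levelZeta (N : ℕ) {n : ℕ} (k : Fin n → ℕ) (a : Fin n → ZMod N) : ℝ :=
  ∑' m : {m : Fin n → ℕ // StrictAnti m ∧ (∀ i, 0 < m i) ∧ ∀ i, ((m i : ℕ) : ZMod N) = a i},
    (N : ℝ) ^ n / ∏ i, (m.1 i : ℝ) ^ k i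

/-- The one-form integrands: `Ω_0 = dt/t` and `Ω_b = N t^{b-1} dt/(1-t^N)` for `b ∈ {1,…,N}`. -/
noncomputable def oneForm (N : ℕ) (b : ℕ) (t : ℝ) : ℝ :=
  if b = 0 then 1 / t else N * t ^ (b - 1) / (1 - t ^ N)

/-- The word `Ω_0^{k₁-1} Ω_{b₁} ⋯ Ω_0^{kₙ-1} Ω_{bₙ}` encoded as the list of symbols
`0,…,0,b₁,0,…,0,b₂,…,0,…,0,bₙ` (with `kᵢ-1` copies of `0` before `bᵢ`). -/
def word {n : ℕ} (k : Fin n → ℕ) (b : Fin n → ℕ) : List ℕ :=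
  (List.ofFn fun i => List.replicate (k i - 1) 0 ++ [b i]).flatten

open scoped ENNReal

/-- The iterated lower Lebesgue integral of `g s₁ ⊗ ⋯ ⊗ g s_K` over `x > t₁ > ⋯ > t_K > 0`,
for a list of symbols `s₁, …, s_K`. -/
noncomputable def iterLIntegral {α : Type*} (g : α → ℝ → ℝ≥0∞) : List α → ℝ → ℝ≥0∞
  | [], _ => 1
  | s :: w, x => ∫⁻ t in Set.Ioo 0 x, g s t * iterLIntegral g w t

/-- The open simplex `x > t₁ > ⋯ > tₙ > 0`. -/
def openSimplex (n : ℕ) (x : ℝ) : Set (Fin n → ℝ) :=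
  {t | StrictAnti t ∧ (∀ p, 0 < t p) ∧ ∀ p, t p < x}

lemma measurableSet_strictAnti_pos (n : ℕ) :
    MeasurableSet {t : Fin n → ℝ | StrictAnti t ∧ ∀ p, 0 < t p} := by
  have h : {t : Fin n → ℝ | StrictAnti t ∧ ∀ p, 0 < t p} =
      (⋂ i, ⋂ j, ⋂ (_ : i < j), {t | t j < t i}) ∩ ⋂ p, {t | 0 < t p} := by
    ext t
    simp [StrictAnti]
  rw [h]
  refine .inter (.iInter fun i => .iInter fun j => .iInter fun _ => ?_) (.iInter fun p => ?_)
  · exact measurableSet_lt (measurable_pi_apply j) (measurable_pi_apply i)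
  · exact measurableSet_lt measurable_const (measurable_pi_apply p)

lemma measurableSet_openSimplex (n : ℕ) (x : ℝ) : MeasurableSet (openSimplex n x) := by
  have h : openSimplex n x =
      {t : Fin n → ℝ | StrictAnti t ∧ ∀ p, 0 < t p} ∩ ⋂ p, {t | t p < x} := by
    ext t
    simp [openSimplex, and_assoc]
  rw [h]
  exact (measurableSet_strictAnti_pos n).inter
    (.iInter fun p => measurableSet_lt (measurable_pi_apply p) measurable_const)

lemma cons_mem_openSimplex {n : ℕ} {x s : ℝ} {t : Fin n → ℝ} :
    (Fin.cons s t : Fin (n + 1) → ℝ) ∈ openSimplex (n + 1) x ↔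
      s ∈ Set.Ioo 0 x ∧ t ∈ openSimplex n s := by
  simp only [openSimplex, Set.mem_ofPred_eq, Set.mem_Ioo, StrictAnti, Fin.forall_fin_succ,
    Fin.cons_zero, Fin.cons_succ]
  simp only [lt_self_iff_false, Fin.succ_pos, Fin.not_lt_zero, Fin.succ_lt_succ_iff,
    forall_const, false_imp_iff, true_and]
  constructor
  · rintro ⟨⟨h1, h2⟩, ⟨h3, h4⟩, h5, h6⟩
    exact ⟨⟨h3, h5⟩, h2, h4, h1⟩
  · rintro ⟨⟨h3, h5⟩, h2, h4, h1⟩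
    exact ⟨⟨h1, h2⟩, ⟨h3, h4⟩, h5, fun i => (h1 i).trans h5⟩

theorem setLIntegral_openSimplex {α : Type*} {g : α → ℝ → ℝ≥0∞} (hg : ∀ s, Measurable (g s))
    (w : List α) (x : ℝ) :
    ∫⁻ t in openSimplex w.length x, ∏ p, g (w.get p) (t p) = iterLIntegral g w x := by
  induction w generalizing x with
  | nil =>
    have h : openSimplex ([] : List α).length x = Set.univ := by
      ext t
      simp [openSimplex, StrictAnti]
    rw [h]
    simp [iterLIntegral, volume_pi]
  | cons s w ih =>
    change ∫⁻ t in openSimplex (w.length + 1) x,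
      ∏ p : Fin (w.length + 1), g ((s :: w).get p) (t p) = _
    have hmeas : Measurable fun t : Fin (w.length + 1) → ℝ =>
        (openSimplex (w.length + 1) x).indicator
          (fun t => ∏ p : Fin (w.length + 1), g ((s :: w).get p) (t p)) t :=
      (Finset.measurable_prod _ fun p _ =>
        (hg _).comp (measurable_pi_apply p)).indicator (measurableSet_openSimplex _ _)
    rw [← lintegral_indicator (measurableSet_openSimplex _ _)]
    have hmp := (volume_preserving_piFinSuccAbove (fun _ : Fin (w.length + 1) => ℝ) 0).symm
    rw [← hmp.lintegral_comp hmeas, Measure.volume_eq_prod,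
      lintegral_prod _ (by exact (hmeas.comp hmp.measurable).aemeasurable), iterLIntegral,
      ← lintegral_indicator measurableSet_Ioo]
    refine lintegral_congr fun a => ?_
    have hcons : ∀ t : Fin w.length → ℝ,
        (MeasurableEquiv.piFinSuccAbove (fun _ : Fin (w.length + 1) => ℝ) 0).symm (a, t) =
          (Fin.cons a t : Fin (w.length + 1) → ℝ) := fun t => by
      simp [MeasurableEquiv.piFinSuccAbove, Fin.consEquiv]
    simp only [hcons]
    by_cases ha : a ∈ Set.Ioo 0 x
    · rw [Set.indicator_of_mem ha, ← ih a, ← lintegral_indicator (measurableSet_openSimplex _ _),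
        ← lintegral_const_mul]
      · refine lintegral_congr fun t => ?_
        by_cases ht : t ∈ openSimplex w.length a
        · rw [Set.indicator_of_mem ht, Set.indicator_of_mem (cons_mem_openSimplex.2 ⟨ha, ht⟩),
            Fin.prod_univ_succ]
          simp
        · rw [Set.indicator_of_notMem ht,
            Set.indicator_of_notMem fun h => ht (cons_mem_openSimplex.1 h).2, mul_zero]
      · exact (Finset.measurable_prod _ fun p _ =>
          (hg _).comp (measurable_pi_apply p)).indicator (measurableSet_openSimplex _ _)
    · rw [Set.indicator_of_notMem ha]
      refine (lintegral_congr fun t => ?_).trans lintegral_zero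
      rw [Set.indicator_of_notMem fun h => ha (cons_mem_openSimplex.1 h).1]

lemma setLIntegral_Ioo_pow (n : ℕ) {x : ℝ} (hx : 0 ≤ x) :
    ∫⁻ t in Set.Ioo 0 x, ENNReal.ofReal t ^ n =
      ((n + 1 : ℕ) : ℝ≥0∞)⁻¹ * ENNReal.ofReal x ^ (n + 1) := by
  have h1 : ∫⁻ t in Set.Ioo 0 x, ENNReal.ofReal t ^ n =
      ∫⁻ t in Set.Ioc 0 x, ENNReal.ofReal (t ^ n) := by
    rw [restrict_Ioo_eq_restrict_Ioc]
    exact setLIntegral_congr_fun measurableSet_Ioc fun t ht =>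
      (ENNReal.ofReal_pow ht.1.le n).symm
  rw [h1, ← ofReal_integral_eq_lintegral_ofReal, ← intervalIntegral.integral_of_le hx,
    integral_pow, zero_pow n.succ_ne_zero, sub_zero, ENNReal.ofReal_div_of_pos (by positivity),
    ENNReal.ofReal_pow hx, div_eq_mul_inv, mul_comm]
  · congr 2
    rw [← ENNReal.ofReal_natCast]
    push_cast
    rfl
  · exact (continuous_pow n).integrableOn_Ioc
  · exact (ae_restrict_iff' measurableSet_Ioc).2 (.of_forall fun t ht => pow_nonneg ht.1.le n)

lemma ofReal_oneForm_zero_mul_pow (N : ℕ) {m : ℕ} (hm : 0 < m) {t : ℝ} (ht : 0 < t) :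
    ENNReal.ofReal (oneForm N 0 t) * ENNReal.ofReal t ^ m = ENNReal.ofReal t ^ (m - 1) := by
  obtain ⟨m, rfl⟩ := Nat.exists_eq_succ_of_ne_zero hm.ne'
  rw [← ENNReal.ofReal_pow ht.le, ← ENNReal.ofReal_pow ht.le, oneForm, if_pos rfl,
    ← ENNReal.ofReal_mul (by positivity)]
  congr 1
  simp [pow_succ]
  field_simp

lemma ofReal_oneForm_mul_pow {N b : ℕ} (hN : 0 < N) (hb : 1 ≤ b) (m : ℕ) {t : ℝ}
    (ht : t ∈ Set.Ioo (0 : ℝ) 1) :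
    ENNReal.ofReal (oneForm N b t) * ENNReal.ofReal t ^ m =
      ∑' j : ℕ, (N : ℝ≥0∞) * ENNReal.ofReal t ^ (m + (b - 1) + N * j) := by
  have hlt : t ^ N < 1 := pow_lt_one₀ ht.1.le ht.2 hN.ne'
  have ht0 : 0 < t := ht.1
  have hs := hasSum_geometric_of_lt_one (pow_nonneg ht.1.le N) hlt
  have hs' := hs.mul_left ((N : ℝ) * t ^ (m + (b - 1)))
  have hterm : ∀ j : ℕ, (N : ℝ≥0∞) * ENNReal.ofReal t ^ (m + (b - 1) + N * j) =
      ENNReal.ofReal ((N : ℝ) * t ^ (m + (b - 1)) * (t ^ N) ^ j) := fun j => by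
    rw [mul_assoc, ← pow_mul, ← pow_add, ENNReal.ofReal_mul (by positivity),
      ENNReal.ofReal_natCast, ENNReal.ofReal_pow ht.1.le]
  simp only [hterm]
  rw [← ENNReal.ofReal_tsum_of_nonneg (fun j => by positivity) hs'.summable, hs'.tsum_eq,
    ← ENNReal.ofReal_pow ht.1.le, oneForm, if_neg (by omega), mul_comm,
    ← ENNReal.ofReal_mul (by positivity)]
  congr 1
  rw [pow_add]
  ring

section IterLIntegral

variable {ι : Type*} [Countable ι] {N : ℕ} {w : List ℕ} {C : ι → ℝ≥0∞} {h : ι → ℕ}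

local notation "J" => iterLIntegral fun s t => ENNReal.ofReal (oneForm N s t)

lemma iterLIntegral_replicate_zero_append (r : ℕ) (hh : ∀ i, 0 < h i)
    (hw : ∀ x ∈ Set.Ioc (0 : ℝ) 1, J w x = ∑' i, C i * ENNReal.ofReal x ^ h i)
    {x : ℝ} (hx : x ∈ Set.Ioc (0 : ℝ) 1) :
    J (List.replicate r 0 ++ w) x =
      ∑' i, C i * (h i : ℝ≥0∞)⁻¹ ^ r * ENNReal.ofReal x ^ h i := by
  induction r generalizing x with
  | zero => simpa using hw x hx
  | succ r ih =>
    rw [List.replicate_succ, List.cons_append, iterLIntegral]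
    have hcongr : ∀ t ∈ Set.Ioo 0 x,
        ENNReal.ofReal (oneForm N 0 t) * J (List.replicate r 0 ++ w) t =
          ∑' i, C i * (h i : ℝ≥0∞)⁻¹ ^ r * ENNReal.ofReal t ^ (h i - 1) := fun t ht => by
      rw [ih ⟨ht.1, ht.2.le.trans hx.2⟩, ← ENNReal.tsum_mul_left]
      refine tsum_congr fun i => ?_
      rw [mul_left_comm, ofReal_oneForm_zero_mul_pow N (hh i) ht.1]
    rw [setLIntegral_congr_fun measurableSet_Ioo hcongr, lintegral_tsum fun i => by fun_prop]
    refine tsum_congr fun i => ?_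
    rw [lintegral_const_mul _ (by fun_prop), setLIntegral_Ioo_pow _ hx.1.le,
      Nat.sub_add_cancel (hh i), pow_succ]
    ring

lemma iterLIntegral_cons {b : ℕ} (hN : 0 < N) (hb : 1 ≤ b)
    (hw : ∀ x ∈ Set.Ioc (0 : ℝ) 1, J w x = ∑' i, C i * ENNReal.ofReal x ^ h i)
    {x : ℝ} (hx : x ∈ Set.Ioc (0 : ℝ) 1) :
    J (b :: w) x = ∑' p : ℕ × ι, C p.2 * N * ((b + N * p.1 + h p.2 : ℕ) : ℝ≥0∞)⁻¹ *
      ENNReal.ofReal x ^ (b + N * p.1 + h p.2) := by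
  rw [iterLIntegral]
  have hcongr : ∀ t ∈ Set.Ioo 0 x, ENNReal.ofReal (oneForm N b t) * J w t =
      ∑' p : ℕ × ι, C p.2 * N * ENNReal.ofReal t ^ (b + N * p.1 + h p.2 - 1) := fun t ht => by
    rw [hw t ⟨ht.1, ht.2.le.trans hx.2⟩, ← ENNReal.tsum_mul_left,
      ENNReal.tsum_prod (f := fun j i =>
        C i * N * ENNReal.ofReal t ^ (b + N * j + h i - 1)), ENNReal.tsum_comm]
    refine tsum_congr fun i => ?_
    rw [mul_left_comm, ofReal_oneForm_mul_pow hN hb _ ⟨ht.1, ht.2.trans_le hx.2⟩,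
      ← ENNReal.tsum_mul_left]
    refine tsum_congr fun j => ?_
    rw [mul_assoc, show h i + (b - 1) + N * j = b + N * j + h i - 1 by omega]
  rw [setLIntegral_congr_fun measurableSet_Ioo hcongr, lintegral_tsum fun i => by fun_prop]
  refine tsum_congr fun p => ?_
  rw [lintegral_const_mul _ (by fun_prop), setLIntegral_Ioo_pow _ hx.1.le,
    Nat.sub_add_cancel (by omega)]
  ring

end IterLIntegral

/-- The tail sums `mᵢ = Σ_{l ≥ i} (b_l + N j_l)`; for varying `j` these run through the decreasing
sequences in the summation range of a level `N` multiple zeta value. -/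
def tailSum (N : ℕ) {n : ℕ} (b j : Fin n → ℕ) (i : Fin n) : ℕ :=
  ∑ l ∈ Finset.univ.filter fun l => i ≤ l, (b l + N * j l)

section TailSum

variable {N n : ℕ}

lemma tailSum_zero (b j : Fin (n + 1) → ℕ) :
    tailSum N b j 0 = b 0 + N * j 0 + ∑ l : Fin n, (b l.succ + N * j l.succ) := by
  simp [tailSum, Fin.sum_univ_succ]

lemma tailSum_succ (b j : Fin (n + 1) → ℕ) (i : Fin n) :
    tailSum N b j i.succ = tailSum N (Fin.tail b) (Fin.tail j) i := by
  simp [tailSum, Finset.sum_filter, Fin.sum_univ_succ, Fin.tail]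

lemma tailSum_cast (b j : Fin n → ℕ) (i : Fin n) :
    ((tailSum N b j i : ℕ) : ZMod N) =
      ((∑ l ∈ Finset.univ.filter fun l => i ≤ l, b l : ℕ) : ZMod N) := by
  simp [tailSum]

lemma tailSum_strictAnti {b : Fin n → ℕ} (hb : ∀ i, 1 ≤ b i) (j : Fin n → ℕ) :
    StrictAnti (tailSum N b j) := by
  intro i i' hi
  refine Finset.sum_lt_sum_of_subset (i := i) (fun l hl => ?_) (by simp) (by simpa using hi)
    (by have := hb i; omega) (fun _ _ _ => Nat.zero_le _)
  simp only [Finset.mem_filter, Finset.mem_univ, true_and] at hl ⊢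
  exact hi.le.trans hl

lemma tailSum_pos {b : Fin n → ℕ} (hb : ∀ i, 1 ≤ b i) (j : Fin n → ℕ) (i : Fin n) :
    0 < tailSum N b j i :=
  Finset.sum_pos (fun l _ => by have := hb l; omega) ⟨i, by simp⟩

lemma tailSum_injective (hN : 0 < N) (b : Fin n → ℕ) : Function.Injective (tailSum N b) := by
  induction n with
  | zero => exact fun _ _ _ => Subsingleton.elim _ _
  | succ n ih =>
    intro j j' hj
    have ht : Fin.tail j = Fin.tail j' := ih (Fin.tail b) <| funext fun i => by
      rw [← tailSum_succ, ← tailSum_succ, hj]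
    have h0 := congrFun hj 0
    have hs : ∀ l : Fin n, j l.succ = j' l.succ := congrFun ht
    simp only [tailSum_zero, hs] at h0
    have h0' : N * j 0 = N * j' 0 := by omega
    exact funext (Fin.cases (Nat.eq_of_mul_eq_mul_left hN h0') hs)

lemma exists_tailSum_eq {b m : Fin n → ℕ} (hb : ∀ i, 1 ≤ b i ∧ b i ≤ N)
    (hm : StrictAnti m) (hpos : ∀ i, 0 < m i)
    (hmod : ∀ i, ((m i : ℕ) : ZMod N) =
      ((∑ l ∈ Finset.univ.filter fun l => i ≤ l, b l : ℕ) : ZMod N)) :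
    ∃ j, tailSum N b j = m := by
  induction n with
  | zero => exact ⟨m, Subsingleton.elim _ _⟩
  | succ n ih =>
    obtain ⟨j, hj⟩ := ih (b := Fin.tail b) (m := Fin.tail m) (fun i => hb i.succ)
      (fun i i' hi => hm (Fin.succ_lt_succ_iff.2 hi)) (fun i => hpos i.succ) (fun i => by
        simpa [Finset.sum_filter, Fin.sum_univ_succ, Fin.tail] using hmod i.succ)
    set h := ∑ l : Fin n, (Fin.tail b l + N * j l) with hh
    have hlt : h < m 0 := by
      cases n with
      | zero => simpa [hh] using hpos 0
      | succ n =>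
        have h1 : h = m 1 := by
          have := congrFun hj 0
          simpa [tailSum, hh, Fin.tail] using this
        rw [h1]
        exact hm (by simp)
    have hdvd : (N : ℤ) ∣ (m 0 : ℤ) - (b 0 + h) := by
      have := hmod 0
      rw [← ZMod.intCast_zmod_eq_zero_iff_dvd]
      simp only [Fin.zero_le, Finset.filter_true, Fin.sum_univ_succ] at this
      push_cast at this ⊢
      simp [this, hh, Fin.tail]
    obtain ⟨c, hc⟩ := hdvd
    have hb0 := hb 0
    have hc0 : 0 ≤ c := by
      by_contra! hneg
      nlinarith
    lift c to ℕ using hc0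
    refine ⟨Fin.cons c j, funext (Fin.cases ?_ fun i => ?_)⟩
    · rw [tailSum_zero]
      simp only [Fin.cons_zero, Fin.cons_succ]
      change b 0 + N * c + h = m 0
      zify
      linarith
    · rw [tailSum_succ, Fin.tail_cons, hj]
      rfl

/-- Tail sums parametrise the summation range of a level `N` multiple zeta value. -/
noncomputable def tailSumEquiv (hN : 0 < N) {b : Fin n → ℕ} (hb : ∀ i, 1 ≤ b i ∧ b i ≤ N) :
    (Fin n → ℕ) ≃ {m : Fin n → ℕ // StrictAnti m ∧ (∀ i, 0 < m i) ∧ ∀ i, ((m i : ℕ) : ZMod N) =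
      ((∑ l ∈ Finset.univ.filter fun l => i ≤ l, b l : ℕ) : ZMod N)} :=
  Equiv.ofBijective
    (fun j => ⟨tailSum N b j, tailSum_strictAnti (fun i => (hb i).1) j,
      tailSum_pos (fun i => (hb i).1) j, tailSum_cast b j⟩)
    ⟨fun _ _ h => tailSum_injective hN b (congrArg Subtype.val h),
      fun ⟨_, hm, hpos, hmod⟩ =>
        (exists_tailSum_eq hb hm hpos hmod).imp fun _ hj => Subtype.ext hj⟩

end TailSum

lemma word_succ {n : ℕ} (k b : Fin (n + 1) → ℕ) :
    word k b =
      List.replicate (k 0 - 1) 0 ++ (b 0 :: word (Fin.tail k) (Fin.tail b)) := by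
  simp [word, List.ofFn_succ, Fin.tail]

theorem iterLIntegral_word {N : ℕ} (hN : 0 < N) {n : ℕ} {k b : Fin n → ℕ}
    (hk : ∀ i, 1 ≤ k i) (hb : ∀ i, 1 ≤ b i) {x : ℝ} (hx : x ∈ Set.Ioc (0 : ℝ) 1) :
    iterLIntegral (fun s t => ENNReal.ofReal (oneForm N s t)) (word k b) x =
      ∑' j : Fin n → ℕ, (N : ℝ≥0∞) ^ n * (∏ i, (tailSum N b j i : ℝ≥0∞)⁻¹ ^ k i) *
        ENNReal.ofReal x ^ (∑ l, (b l + N * j l)) := by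
  induction n generalizing x with
  | zero => simp [word, iterLIntegral]
  | succ n ih =>
    rw [word_succ, iterLIntegral_replicate_zero_append (k 0 - 1)
      (fun p => by have := hb 0; omega)
      (fun y hy => iterLIntegral_cons hN (hb 0)
        (fun z hz => ih (k := Fin.tail k) (b := Fin.tail b)
          (fun i => hk i.succ) (fun i => hb i.succ) hz) hy) hx,
      ← (Fin.consEquiv fun _ : Fin (n + 1) => ℕ).tsum_eq]
    refine tsum_congr fun ⟨c, j⟩ => ?_
    obtain ⟨r, hr⟩ := Nat.exists_eq_add_of_le' (hk 0)
    have htail : Fin.tail (Fin.consEquiv (fun _ : Fin (n + 1) => ℕ) (c, j)) = j := rfl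
    simp only [Fin.prod_univ_succ, tailSum_zero, tailSum_succ, htail]
    simp only [Fin.consEquiv_apply, Fin.cons_zero, Fin.cons_succ, Fin.sum_univ_succ, hr,
      Nat.add_sub_cancel, Fin.tail]
    ring

lemma measurable_oneForm (N s : ℕ) : Measurable (oneForm N s) := by
  unfold oneForm
  split_ifs <;> fun_prop

lemma oneForm_nonneg (N s : ℕ) {t : ℝ} (h0 : 0 < t) (h1 : t < 1) : 0 ≤ oneForm N s t := by
  unfold oneForm
  have : t ^ N ≤ 1 := pow_le_one₀ h0.le h1.le
  have : 0 ≤ 1 - t ^ N := by linarith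
  split_ifs <;> positivity

theorem iterated_integral_eq_levelZeta (N : ℕ) (hN : 0 < N) (n : ℕ) (hn : 0 < n)
    (k : Fin n → ℕ) (hk : ∀ i, 1 ≤ k i) (hk1 : 2 ≤ k ⟨0, hn⟩)
    (b : Fin n → ℕ) (hb : ∀ i, 1 ≤ b i ∧ b i ≤ N) :
    (∫ t in {t : Fin (word k b).length → ℝ |
        StrictAnti t ∧ (∀ p, 0 < t p) ∧ ∀ p, t p < 1},
      ∏ p, oneForm N ((word k b).get p) (t p))
      = levelZeta N k (fun i => ((∑ j ∈ Finset.univ.filter fun j => i ≤ j, b j : ℕ) : ZMod N)) := by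
  change ∫ t in openSimplex (word k b).length 1, _ = _
  have hnonneg : ∀ t ∈ openSimplex (word k b).length 1,
      ∀ p, 0 ≤ oneForm N ((word k b).get p) (t p) :=
    fun t ht p => oneForm_nonneg _ _ (ht.2.1 p) (ht.2.2 p)
  have hmeas : Measurable fun t : Fin (word k b).length → ℝ =>
      ∏ p, oneForm N ((word k b).get p) (t p) :=
    Finset.measurable_prod _ fun p _ => (measurable_oneForm _ _).comp (measurable_pi_apply p)
  rw [integral_eq_lintegral_of_nonneg_ae
    ((ae_restrict_iff' (measurableSet_openSimplex _ _)).2 <| .of_forall fun t ht =>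
      Finset.prod_nonneg fun p _ => hnonneg t ht p) hmeas.aestronglyMeasurable,
    setLIntegral_congr_fun (measurableSet_openSimplex _ _) fun t ht =>
      ENNReal.ofReal_prod_of_nonneg fun p _ => hnonneg t ht p,
    setLIntegral_openSimplex (g := fun s t => ENNReal.ofReal (oneForm N s t))
      (fun s => (measurable_oneForm N s).ennreal_ofReal),
    iterLIntegral_word hN hk (fun i => (hb i).1) (Set.right_mem_Ioc.2 one_pos), levelZeta,
    ← (tailSumEquiv hN hb).tsum_eq, ENNReal.tsum_toReal_eq fun j => ?_]
  · refine tsum_congr fun j => ?_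
    have hj : (tailSumEquiv hN hb j).1 = tailSum N b j := rfl
    simp [hj, ENNReal.toReal_prod, div_eq_mul_inv]
  · have hinv : ∀ i, ((tailSum N b j i : ℕ) : ℝ≥0∞)⁻¹ ≠ ∞ := fun i => by
      simpa using (tailSum_pos (fun i => (hb i).1) j i).ne'
    simpa using ENNReal.mul_ne_top (by simp)
      (ENNReal.prod_ne_top fun i _ => ENNReal.pow_ne_top (hinv i))
end

section
/- For every integer k ≥ 3, Σ_{j=2}^{k−1} ζ^{(2)}(j, \overline{k−j}) = ζ^{(2)}(\overline{k−1}, 1) − ζ^{(2)}(\overline{k−1}, \overline{1}) + ζ^{(2)}(\overline{k}). -/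
/-- `altDoubleZeta a b j l = Σ_{m>n>0} (-1)^(a·m + b·n)/(m^j n^l)`: for `a,b ∈ {0,1}` these are
the (alternating) double zeta values of level 2; a bar on an entry corresponds to sign `1`. -/
noncomputable def altDoubleZeta (a b : ℕ) (j l : ℕ) : ℝ :=
  ∑' p : {p : ℕ × ℕ // p.2 < p.1 ∧ 0 < p.2},
    (-1 : ℝ) ^ (a * p.1.1 + b * p.1.2) / ((p.1.1 : ℝ) ^ j * (p.1.2 : ℝ) ^ l)

/-- ;  and
. -/
noncomputable def altSingleZeta (a : ℕ) (k : ℕ) : ℝ :=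
  ∑' m : {m : ℕ // 0 < m}, (-1 : ℝ) ^ (a * m.1) / (m.1 : ℝ) ^ k

/-- Pairs `m > n > 0` are parametrized by `n - 1` and `m - n - 1`. -/
def gapEquiv : ℕ × ℕ ≃ {p : ℕ × ℕ // p.2 < p.1 ∧ 0 < p.2} where
  toFun q := ⟨(q.1 + q.2 + 2, q.1 + 1), by simp⟩
  invFun p := (p.1.2 - 1, p.1.1 - p.1.2 - 1)
  left_inv q := by ext <;> simp; omega
  right_inv p := by
    obtain ⟨⟨m, n⟩, h⟩ := p
    simp only at h
    ext <;> simp <;> omega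

/-- The summand of `altDoubleZeta` in the coordinates of `gapEquiv`. -/
noncomputable def altDoubleZetaTerm (a b j l : ℕ) (q : ℕ × ℕ) : ℝ :=
  (-1 : ℝ) ^ (a * (q.1 + q.2 + 2) + b * (q.1 + 1)) /
    (((q.1 : ℝ) + q.2 + 2) ^ j * ((q.1 : ℝ) + 1) ^ l)

theorem altDoubleZeta_eq_tsum (a b j l : ℕ) :
    altDoubleZeta a b j l = ∑' q, altDoubleZetaTerm a b j l q := by
  rw [altDoubleZeta, ← gapEquiv.tsum_eq]
  simp [gapEquiv, altDoubleZetaTerm]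

theorem summable_one_div_mul_mul_add :
    Summable fun q : ℕ × ℕ =>
      1 / (((q.1 : ℝ) + 1) * ((q.2 : ℝ) + 1) * ((q.1 : ℝ) + q.2 + 2)) := by
  have h : Summable fun n : ℕ => 1 / (((n : ℝ) + 1) * √((n : ℝ) + 1)) := by
    have h0 : Summable fun n : ℕ => 1 / (n : ℝ) ^ (3 / 2 : ℝ) :=
      Real.summable_one_div_nat_rpow.2 (by norm_num)
    refine ((summable_nat_add_iff 1).2 h0).congr fun n => ?_
    have hn : (0 : ℝ) < n + 1 := by positivity
    rw [Real.sqrt_eq_rpow, show (3 / 2 : ℝ) = 1 + 1 / 2 by norm_num]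
    push_cast
    rw [Real.rpow_add hn, Real.rpow_one]
  refine Summable.of_nonneg_of_le (fun q => by positivity) (fun q => ?_)
    (h.mul_of_nonneg h (fun n => by positivity) fun n => by positivity)
  have h1 : (0 : ℝ) ≤ q.1 + 1 := by positivity
  have h2 : (0 : ℝ) ≤ q.2 + 1 := by positivity
  rw [div_mul_div_comm, one_mul]
  refine one_div_le_one_div_of_le (by positivity) ?_
  have key : √((q.1 : ℝ) + 1) * √((q.2 : ℝ) + 1) ≤ (q.1 : ℝ) + q.2 + 2 := by
    nlinarith [sq_nonneg (√((q.1 : ℝ) + 1) - √((q.2 : ℝ) + 1)), Real.sq_sqrt h1, Real.sq_sqrt h2]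
  calc _ = (((q.1 : ℝ) + 1) * ((q.2 : ℝ) + 1)) * (√((q.1 : ℝ) + 1) * √((q.2 : ℝ) + 1)) := by ring
    _ ≤ _ := by gcongr

theorem summable_altDoubleZetaTerm (a b : ℕ) {j l : ℕ} (hj : 2 ≤ j) (hl : 1 ≤ l) :
    Summable (altDoubleZetaTerm a b j l) := by
  refine Summable.of_norm_bounded summable_one_div_mul_mul_add fun q => ?_
  have h1 : (1 : ℝ) ≤ q.1 + 1 := by simp
  have h3 : (1 : ℝ) ≤ (q.1 : ℝ) + q.2 + 2 := by
    have := q.1.cast_nonneg (α := ℝ)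
    have := q.2.cast_nonneg (α := ℝ)
    linarith
  rw [altDoubleZetaTerm, norm_div, norm_pow, norm_neg, norm_one, one_pow,
    Real.norm_of_nonneg (by positivity)]
  refine one_div_le_one_div_of_le (by positivity) ?_
  calc _ = (((q.2 : ℝ) + 1) * ((q.1 : ℝ) + q.2 + 2)) * ((q.1 : ℝ) + 1) := by ring
    _ ≤ ((q.1 : ℝ) + q.2 + 2) ^ 2 * ((q.1 : ℝ) + 1) ^ 1 := by
      rw [sq, pow_one]
      gcongr ?_ * _ * _
      have := q.1.cast_nonneg (α := ℝ)
      linarith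
    _ ≤ _ := mul_le_mul (pow_le_pow_right₀ h3 hj) (pow_le_pow_right₀ h1 hl)
        (by positivity) (by positivity)

theorem hasSum_one_div_mul_add (n : ℕ) :
    HasSum (fun r : ℕ => 1 / (((r : ℝ) + 1) * ((n : ℝ) + r + 2)))
      ((∑ i ∈ Finset.range (n + 1), 1 / ((i : ℝ) + 1)) / (n + 1)) := by
  have step (i : ℕ) : HasSum (fun r : ℕ => 1 / ((r : ℝ) + i + 1) - 1 / ((r : ℝ) + i + 2))
      (1 / ((i : ℝ) + 1)) := by
    rw [hasSum_iff_tendsto_nat_of_nonneg]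
    · have h (N : ℕ) : ∑ r ∈ Finset.range N, (1 / ((r : ℝ) + i + 1) - 1 / ((r : ℝ) + i + 2))
          = 1 / ((i : ℝ) + 1) - 1 / (((N + i : ℕ) : ℝ) + 1) := by
        have := Finset.sum_range_sub' (fun r : ℕ => 1 / ((r : ℝ) + i + 1)) N
        push_cast at this ⊢
        rw [zero_add] at this
        rw [← this]
        refine Finset.sum_congr rfl fun r _ => ?_
        ring
      simp_rw [h]
      simpa using ((Filter.tendsto_add_atTop_iff_nat i).2
        (tendsto_one_div_add_atTop_nhds_zero_nat (𝕜 := ℝ))).const_sub (1 / ((i : ℝ) + 1))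
    · intro r
      rw [sub_nonneg]
      exact one_div_le_one_div_of_le (by positivity) (by linarith)
  refine ((hasSum_sum fun i (_ : i ∈ Finset.range (n + 1)) => step i).div_const
    ((n : ℝ) + 1)).congr_fun ?_
  intro r
  have := Finset.sum_range_sub' (fun i : ℕ => 1 / ((r : ℝ) + i + 1)) (n + 1)
  rw [Finset.sum_congr rfl (g := fun i : ℕ => 1 / ((r : ℝ) + i + 1) -
    1 / ((r : ℝ) + (i + 1 : ℕ) + 1)) (fun i _ => by push_cast; ring), this]
  have : (0 : ℝ) < r + n + 2 := by positivity
  push_cast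
  field_simp
  ring

theorem hasSum_harmonic_altDoubleZeta_add_altSingleZeta {s : ℕ} (hs : 2 ≤ s) :
    HasSum (fun n : ℕ => (-1 : ℝ) ^ (n + 1) / ((n : ℝ) + 1) ^ s *
        ∑ i ∈ Finset.range (n + 1), 1 / ((i : ℝ) + 1))
      (altDoubleZeta 1 0 s 1 + altSingleZeta 1 (s + 1)) := by
  have hd : HasSum (fun n : ℕ => (-1 : ℝ) ^ (n + 1) / ((n : ℝ) + 1) ^ s *
      ∑ i ∈ Finset.range n, 1 / ((i : ℝ) + 1)) (altDoubleZeta 1 0 s 1) := by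
    rw [← hasSum_nat_add_iff' 1, altDoubleZeta_eq_tsum]
    have h := (Finset.HasAntidiagonal.sigmaAntidiagonalEquivProd (A := ℕ)).hasSum_iff.2
      (summable_altDoubleZetaTerm 1 0 hs le_rfl).hasSum
    have h2 := h.sigma fun n => hasSum_fintype _
    simp only [Finset.range_one, Finset.sum_singleton, Finset.range_zero, Finset.sum_empty,
      mul_zero, sub_zero]
    refine h2.congr_fun fun n => ?_
    rw [Finset.univ_eq_attach]
    refine Eq.trans ?_ (Finset.sum_attach (Finset.HasAntidiagonal.antidiagonal n)
      (fun q => altDoubleZetaTerm 1 0 s 1 q)).symm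
    rw [Finset.mul_sum,
      Finset.Nat.sum_antidiagonal_eq_sum_range_succ_mk]
    refine Finset.sum_congr rfl fun i hi => ?_
    have hi' : i ≤ n := Nat.lt_succ_iff.1 (Finset.mem_range.1 hi)
    simp only [altDoubleZetaTerm]
    rw [show 1 * (i + (n - i) + 2) + 0 * (i + 1) = n + 1 + 1 by omega, Nat.cast_sub hi']
    push_cast
    rw [show (i : ℝ) + (n - i) + 2 = n + 1 + 1 by ring, pow_one, div_mul_div_comm, mul_one]
  have hz : HasSum (fun n : ℕ => (-1 : ℝ) ^ (n + 1) / ((n : ℝ) + 1) ^ (s + 1))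
      (altSingleZeta 1 (s + 1)) := by
    have hsum : Summable fun n : ℕ => (-1 : ℝ) ^ (n + 1) / ((n : ℝ) + 1) ^ (s + 1) := by
      refine Summable.of_norm_bounded ((summable_nat_add_iff 1).2
        (Real.summable_one_div_nat_pow (p := s + 1).2 (by omega))) fun n => ?_
      rw [norm_div, norm_pow, norm_neg, norm_one, one_pow, Real.norm_of_nonneg (by positivity)]
      push_cast
      rfl
    have he : altSingleZeta 1 (s + 1) = ∑' n : ℕ, (-1 : ℝ) ^ (n + 1) / ((n : ℝ) + 1) ^ (s + 1) := by
      rw [altSingleZeta]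
      refine (Equiv.pnatEquivNat.symm.tsum_eq _).symm.trans (tsum_congr fun n => ?_)
      simp [Equiv.pnatEquivNat, Nat.succPNat]
    exact he ▸ hsum.hasSum
  refine (hd.add hz).congr_fun fun n => ?_
  rw [Finset.sum_range_succ, mul_add, div_mul_div_comm, mul_one, pow_succ _ s]

/-- Partial fractions together with the geometric sum. -/
theorem sum_altDoubleZetaTerm {k : ℕ} (hk : 3 ≤ k) (q : ℕ × ℕ) :
    ∑ j ∈ Finset.Icc 2 (k - 1), altDoubleZetaTerm 0 1 j (k - j) q
      = (-1 : ℝ) ^ (q.1 + 1) / ((q.1 : ℝ) + 1) ^ (k - 2) *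
          (1 / (((q.2 : ℝ) + 1) * ((q.1 : ℝ) + q.2 + 2)))
        - altDoubleZetaTerm 1 1 (k - 1) 1 q.swap := by
  obtain ⟨t, rfl⟩ : ∃ t, k = t + 3 := ⟨k - 3, by omega⟩
  obtain ⟨n, r⟩ := q
  have hsign : (-1 : ℝ) ^ (r + n + 2 + (r + 1)) = (-1) ^ (n + 1) := by
    rw [show r + n + 2 + (r + 1) = (n + 1) + 2 * (r + 1) by ring, pow_add, pow_mul]
    simp
  simp only [altDoubleZetaTerm, Prod.swap, zero_mul, zero_add, one_mul, pow_one, hsign]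
  rw [show t + 3 - 1 = t + 2 by omega, show t + 3 - 2 = t + 1 by omega]
  obtain ⟨x, hx⟩ : ∃ x : ℝ, x = n + 1 := ⟨_, rfl⟩
  obtain ⟨y, hy⟩ : ∃ y : ℝ, y = r + 1 := ⟨_, rfl⟩
  have hx0 : 0 < x := by rw [hx]; positivity
  have hy0 : 0 < y := by rw [hy]; positivity
  rw [show (n : ℝ) + r + 2 = x + y by rw [hx, hy]; ring,
    show (r : ℝ) + n + 2 = x + y by rw [hx, hy]; ring, ← hx, ← hy]
  generalize (-1 : ℝ) ^ (n + 1) = e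
  induction t with
  | zero =>
    simp
    field_simp
    ring
  | succ t ih =>
    rw [Finset.sum_Icc_succ_top (by omega), Finset.sum_congr rfl
      (g := fun j => 1 / x * (e / ((x + y) ^ j * x ^ (t + 3 - j)))), ← Finset.mul_sum, ih (by omega)]
    · rw [show t + 1 + 3 - (t + 1 + 2) = 1 by omega]
      field_simp
      ring
    · intro j hj
      rw [show t + 1 + 3 - j = t + 3 - j + 1 by have := Finset.mem_Icc.1 hj; omega, pow_succ]
      field_simp

theorem sum_formula_level2_case01 (k : ℕ) (hk : 3 ≤ k) :
    ∑ j ∈ Finset.Icc 2 (k - 1), altDoubleZeta 0 1 j (k - j)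
      = altDoubleZeta 1 0 (k - 1) 1 - altDoubleZeta 1 1 (k - 1) 1 + altSingleZeta 1 k := by
  have hL : HasSum
      (fun q => ∑ j ∈ Finset.Icc 2 (k - 1), altDoubleZetaTerm 0 1 j (k - j) q)
      (∑ j ∈ Finset.Icc 2 (k - 1), altDoubleZeta 0 1 j (k - j)) := by
    refine hasSum_sum fun j hj => ?_
    rw [Finset.mem_Icc] at hj
    rw [altDoubleZeta_eq_tsum]
    exact (summable_altDoubleZetaTerm 0 1 hj.1 (by omega)).hasSum
  have hS : HasSum (fun q : ℕ × ℕ => altDoubleZetaTerm 1 1 (k - 1) 1 q.swap)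
      (altDoubleZeta 1 1 (k - 1) 1) := by
    rw [altDoubleZeta_eq_tsum]
    exact (Equiv.prodComm ℕ ℕ).hasSum_iff.2
      (summable_altDoubleZetaTerm 1 1 (by omega) le_rfl).hasSum
  have hA := (hL.add hS).prod_fiberwise fun n => by
    simp only [sum_altDoubleZetaTerm hk, sub_add_cancel]
    exact (hasSum_one_div_mul_add n).mul_left _
  have hB := hasSum_harmonic_altDoubleZeta_add_altSingleZeta (s := k - 1) (by omega)
  rw [show k - 1 + 1 = k by omega] at hB
  have := hA.unique (hB.congr_fun fun n => ?_)
  · linarith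
  · rw [show k - 1 = k - 2 + 1 by omega, pow_succ]
    field_simp
    ring
end

section
/- For every integer k ≥ 3, Σ_{j=2}^{k−1} 2^{j} ζ^{(2)}(j, \overline{k−j}) + Σ_{j=2}^{k−1} 2^{j} ζ^{(2)}(\overline{j}, \overline{k−j}) = 2 ζ(k) + 2k ζ^{(2)}(\overline{k}). -/
open Finset Filter Topology

/-- The partial-fraction form of `∑ x ^ i * y ^ j` over `i + j = q + 3`, `2 ≤ i`, `1 ≤ j`, where
`x = 1 / a` and `y = 1 / b`. -/
lemma sum_one_div_pow_mul_pow {a b : ℝ} (ha : a ≠ 0) (hb : b ≠ 0) (hab : a ≠ b) (q : ℕ) :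
    ∑ i ∈ range (q + 1), 1 / (a ^ (i + 2) * b ^ (q + 1 - i))
      = 1 / (a ^ (q + 2) * (b - a)) + 1 / b ^ (q + 2) * ((a - b)⁻¹ - a⁻¹) := by
  have h1 : b - a ≠ 0 := sub_ne_zero.2 hab.symm
  have h2 : a - b ≠ 0 := sub_ne_zero.2 hab
  have h3 : (a - b)⁻¹ = -(b - a)⁻¹ := by rw [← neg_sub b a, inv_neg]
  rw [h3]
  induction q with
  | zero =>
    simp only [zero_add, range_one, sum_singleton]
    field_simp
    ring
  | succ q ih =>
    have step : ∑ i ∈ range (q + 1), 1 / (a ^ (i + 2) * b ^ (q + 1 + 1 - i))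
        = b⁻¹ * ∑ i ∈ range (q + 1), 1 / (a ^ (i + 2) * b ^ (q + 1 - i)) := by
      rw [mul_sum]
      refine sum_congr rfl fun i hi ↦ ?_
      have : q + 1 + 1 - i = (q + 1 - i) + 1 := by have := mem_range.1 hi; omega
      rw [this, pow_succ b]
      field_simp
    rw [sum_range_succ, step, ih]
    have : q + 1 + 1 - (q + 1) = 1 := by omega
    rw [this]
    field_simp
    ring

lemma summable_one_div_rpow_mul_rpow :
    Summable fun p : ℕ × ℤ ↦
      1 / ((p.1 : ℝ) ^ (3 / 2 : ℝ)) * |(p.2 : ℝ)| ^ (-(3 / 2) : ℝ) :=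
  (Real.summable_one_div_nat_rpow.2 (by norm_num)).mul_of_nonneg
    (Real.summable_abs_int_rpow (by norm_num)) (fun _ ↦ by positivity) (fun _ ↦ by positivity)

lemma inv_pow_mul_pow_le {m d : ℝ} (hd : 1 ≤ d) (hdm : d ≤ m) {j l : ℕ} (hj : 2 ≤ j)
    (hl : 1 ≤ l) :
    1 / (m ^ j * d ^ l) ≤ 1 / m ^ (3 / 2 : ℝ) * d ^ (-(3 / 2) : ℝ) := by
  have hd0 : 0 < d := by linarith
  have hm0 : 0 < m := by linarith
  rw [Real.rpow_neg hd0.le, ← one_div, one_div_mul_one_div]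
  apply one_div_le_one_div_of_le (by positivity)
  calc m ^ (3 / 2 : ℝ) * d ^ (3 / 2 : ℝ)
      = m ^ (3 / 2 : ℝ) * (d ^ (1 / 2 : ℝ) * d) := by
        rw [← Real.rpow_add_one hd0.ne']; norm_num
    _ ≤ m ^ (3 / 2 : ℝ) * (m ^ (1 / 2 : ℝ) * d) := by gcongr
    _ = m ^ 2 * d ^ 1 := by
        rw [← mul_assoc, ← Real.rpow_add hm0]; norm_num
    _ ≤ m ^ j * d ^ l := by
        gcongr
        · linarith

lemma summable_alt_double (a b : ℕ) {j l : ℕ} (hj : 2 ≤ j) (hl : 1 ≤ l) :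
    Summable fun p : ℕ × ℕ ↦ if p.2 < p.1 ∧ 0 < p.2 then
      (-1 : ℝ) ^ (a * p.1 + b * p.2) / ((p.1 : ℝ) ^ j * (p.2 : ℝ) ^ l) else 0 := by
  have hinj : Function.Injective fun p : ℕ × ℕ ↦ (p.1, (p.2 : ℤ)) := by
    rintro ⟨_, _⟩ ⟨_, _⟩ h
    simpa using h
  refine (summable_one_div_rpow_mul_rpow.comp_injective hinj).of_norm_bounded ?_
  rintro ⟨m, n⟩
  simp only [Function.comp_apply, Int.cast_natCast, Nat.abs_cast]
  split_ifs with h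
  · rw [norm_div, norm_pow, norm_neg, norm_one, one_pow, Real.norm_of_nonneg (by positivity)]
    exact inv_pow_mul_pow_le (by exact_mod_cast h.2) (by exact_mod_cast h.1.le) hj hl
  · rw [norm_zero]; positivity

lemma altDoubleZeta_eq_tsum_s13 (a b j l : ℕ) :
    altDoubleZeta a b j l = ∑' p : ℕ × ℕ, if p.2 < p.1 ∧ 0 < p.2 then
      (-1 : ℝ) ^ (a * p.1 + b * p.2) / ((p.1 : ℝ) ^ j * (p.2 : ℝ) ^ l) else 0 := by
  rw [altDoubleZeta]
  refine (tsum_subtype {p : ℕ × ℕ | p.2 < p.1 ∧ 0 < p.2} fun p ↦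
    (-1 : ℝ) ^ (a * p.1 + b * p.2) / ((p.1 : ℝ) ^ j * (p.2 : ℝ) ^ l)).trans ?_
  simp only [Set.indicator_apply, Set.mem_ofPred_eq]

lemma altSingleZeta_eq_tsum (a : ℕ) {k : ℕ} (hk : k ≠ 0) :
    altSingleZeta a k = ∑' m : ℕ, (-1 : ℝ) ^ (a * m) / (m : ℝ) ^ k := by
  rw [altSingleZeta]
  refine (tsum_subtype {m : ℕ | 0 < m} fun m ↦ (-1 : ℝ) ^ (a * m) / (m : ℝ) ^ k).trans ?_
  refine tsum_congr fun m ↦ ?_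
  rcases Nat.eq_zero_or_pos m with rfl | hm
  · simp [hk]
  · rw [Set.indicator_of_mem (by exact hm)]

lemma summable_alt_single (a : ℕ) {k : ℕ} (hk : 2 ≤ k) :
    Summable fun m : ℕ ↦ (-1 : ℝ) ^ (a * m) / (m : ℝ) ^ k := by
  refine (Real.summable_one_div_nat_pow.2 (by omega : 1 < k)).of_norm_bounded fun m ↦ ?_
  rw [norm_div, norm_pow, norm_neg, norm_one, one_pow, Real.norm_of_nonneg (by positivity)]

/-- The terms of the sum over `ζ(j, l̄) + ζ(j̄, l̄)` vanish for odd `m`; the even `m = 2 M` remain. -/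
lemma hasSum_two_pow_mul_altDoubleZeta {j l : ℕ} (hj : 2 ≤ j) (hl : 1 ≤ l) :
    HasSum (fun p : ℕ × ℕ ↦ if 0 < p.2 ∧ p.2 < 2 * p.1 then
      2 * ((-1 : ℝ) ^ p.2 * (1 / ((p.1 : ℝ) ^ j * (p.2 : ℝ) ^ l))) else 0)
      (2 ^ j * altDoubleZeta 0 1 j l + 2 ^ j * altDoubleZeta 1 1 j l) := by
  have h := ((summable_alt_double 0 1 hj hl).hasSum.add
    (summable_alt_double 1 1 hj hl).hasSum).mul_left ((2 : ℝ) ^ j)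
  rw [← altDoubleZeta_eq_tsum_s13, ← altDoubleZeta_eq_tsum_s13, mul_add] at h
  have hinj : Function.Injective fun p : ℕ × ℕ ↦ (2 * p.1, p.2) := by
    rintro ⟨_, _⟩ ⟨_, _⟩ h
    simpa using h
  refine ((hinj.hasSum_iff ?_).2 h).congr_fun ?_
  · rintro ⟨m, n⟩ hx
    have hm : Odd m := by
      rw [← Nat.not_even_iff_odd]
      rintro ⟨M, rfl⟩
      exact hx ⟨(M, n), by simp [two_mul]⟩
    simp only
    split_ifs
    · simp only [zero_mul, zero_add, one_mul, pow_add, hm.neg_one_pow]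
      ring
    · simp
  · rintro ⟨M, n⟩
    simp only [Function.comp_apply]
    by_cases hc : 0 < n ∧ n < 2 * M
    · have hM : (M : ℝ) ≠ 0 := by
        have : M ≠ 0 := by omega
        exact_mod_cast this
      have hn : (n : ℝ) ≠ 0 := by
        have : n ≠ 0 := by omega
        exact_mod_cast this
      rw [if_pos hc, if_pos hc.symm, if_pos hc.symm, pow_add _ (1 * _), one_mul, one_mul, zero_mul,
        zero_add, (even_two_mul M).neg_one_pow, Nat.cast_mul, Nat.cast_ofNat, mul_pow]
      field_simp
      ring
    · rw [if_neg hc, if_neg (fun h ↦ hc h.symm), if_neg (fun h ↦ hc h.symm)]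
      simp

/-- The antisymmetric part sums to zero in `n` by the reflection `n ↦ 2 M - n`. -/
lemma hasSum_antisymmetric {s : ℕ} (hs : 2 ≤ s) :
    HasSum (fun p : ℕ × ℕ ↦ if 0 < p.2 ∧ p.2 < 2 * p.1 then
      (-1 : ℝ) ^ p.2 * (1 / ((p.1 : ℝ) ^ s * ((p.2 : ℝ) - p.1))) else 0) 0 := by
  set G : ℕ × ℕ → ℝ := fun p ↦ if 0 < p.2 ∧ p.2 < 2 * p.1 then
      (-1 : ℝ) ^ p.2 * (1 / ((p.1 : ℝ) ^ s * ((p.2 : ℝ) - p.1))) else 0 with hG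
  have hinj : Function.Injective fun p : ℕ × ℕ ↦ (p.1, (p.2 : ℤ) - p.1) := by
    rintro ⟨_, _⟩ ⟨_, _⟩ h
    simp only [Prod.mk.injEq] at h ⊢
    omega
  have hsum : Summable G := by
    refine (summable_one_div_rpow_mul_rpow.comp_injective hinj).of_norm_bounded ?_
    rintro ⟨M, n⟩
    simp only [hG, Function.comp_apply, Int.cast_sub, Int.cast_natCast]
    split_ifs with h
    · rcases eq_or_ne n M with rfl | hne
      · simp only [sub_self, mul_zero, div_zero, norm_zero]
        positivity
      · rw [norm_mul, norm_pow, norm_neg, norm_one, one_pow, one_mul, norm_div, norm_one, norm_mul,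
          norm_pow, Real.norm_natCast, Real.norm_eq_abs]
        have h1 : (1 : ℝ) ≤ |(n : ℝ) - M| := by
          have : (1 : ℤ) ≤ |(n : ℤ) - M| := Int.one_le_abs (by omega)
          exact_mod_cast this
        have h2 : |(n : ℝ) - M| ≤ M := by
          have : |(n : ℤ) - M| ≤ M := abs_le.2 (by omega)
          exact_mod_cast this
        simpa using inv_pow_mul_pow_le h1 h2 hs le_rfl
    · rw [norm_zero]; positivity
  have hrow (M : ℕ) : ∑' n, G (M, n) = 0 := by
    rw [tsum_eq_sum (s := Ioo 0 (2 * M)) fun n hn ↦ if_neg (by simpa using hn)]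
    have hneg : ∑ n ∈ Ioo 0 (2 * M), G (M, n) = ∑ n ∈ Ioo 0 (2 * M), -G (M, n) := by
      refine sum_nbij' (fun n ↦ 2 * M - n) (fun n ↦ 2 * M - n) ?_ ?_ ?_ ?_ ?_
      · intro n hn; simp only [mem_Ioo] at hn ⊢; omega
      · intro n hn; simp only [mem_Ioo] at hn ⊢; omega
      · intro n hn; simp only [mem_Ioo] at hn ⊢; omega
      · intro n hn; simp only [mem_Ioo] at hn ⊢; omega
      · intro n hn
        simp only [mem_Ioo] at hn
        simp only [hG]
        rw [if_pos hn, if_pos (by omega)]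
        have hpar : (-1 : ℝ) ^ (2 * M - n) = (-1) ^ n :=
          neg_one_pow_congr (by rw [Nat.even_sub hn.2.le]; simp)
        rw [hpar, Nat.cast_sub hn.2.le, ← mul_neg, ← div_neg, ← mul_neg]
        push_cast
        congr 4
        ring
    rw [sum_neg_distrib] at hneg
    linarith
  have := hsum.tsum_prod
  simp only [hrow, tsum_zero] at this
  exact this ▸ hsum.hasSum

lemma sum_harmonic_halves (n : ℕ) (hn : 0 < n) :
    ∑ M ∈ range n, (if n < 2 * M then ((M : ℝ) - n)⁻¹ - (M : ℝ)⁻¹ else 0)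
      = (2 + (-1) ^ n) / n - ∑ i ∈ range n, ((i : ℝ) + 1)⁻¹ := by
  have key (p q : ℕ) (hq : q ≤ p) (hpq : p + 1 + q = n) (hlt : n < 2 * (p + 1))
      (hge : 2 * p ≤ n) :
      ∑ M ∈ range n, (if n < 2 * M then ((M : ℝ) - n)⁻¹ - (M : ℝ)⁻¹ else 0)
        = - ∑ i ∈ range q, ((i : ℝ) + 1)⁻¹ + (∑ i ∈ range p, ((i : ℝ) + 1)⁻¹
          - ∑ i ∈ range (p + q), ((i : ℝ) + 1)⁻¹) := by
    subst hpq
    rw [sum_range_add, sum_range_add (fun i : ℕ ↦ ((i : ℝ) + 1)⁻¹) p q,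
      ← sum_range_reflect (fun i : ℕ ↦ ((i : ℝ) + 1)⁻¹) q, sub_add_cancel_left, ← neg_add,
      ← sum_add_distrib, ← sum_neg_distrib]
    rw [sum_eq_zero fun M hM ↦ if_neg (by have := mem_range.1 hM; omega), zero_add]
    refine sum_congr rfl fun i hi ↦ ?_
    have hi := mem_range.1 hi
    rw [if_pos (by omega), neg_add, ← sub_eq_add_neg]
    congr 1
    · rw [← inv_neg, Nat.sub_sub, Nat.cast_sub (by omega)]
      congr 1
      push_cast
      ring
    · push_cast
      congr 1
      ring
  rcases Nat.even_or_odd' n with ⟨p, rfl | rfl⟩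
  · obtain ⟨q, rfl⟩ : ∃ q, p = q + 1 := ⟨p - 1, by omega⟩
    rw [key (q + 1) q (by omega) (by ring) (by omega) le_rfl, (even_two_mul _).neg_one_pow,
      show 2 * (q + 1) = q + 1 + q + 1 by ring, sum_range_succ _ q, sum_range_succ _ (q + 1 + q)]
    push_cast
    have h1 : (q : ℝ) + 1 ≠ 0 := by positivity
    have h2 : (q : ℝ) + 1 + q + 1 = 2 * (q + 1) := by ring
    rw [h2]
    field_simp
    ring
  · rw [key p p le_rfl (by ring) (by omega) (by omega), (odd_two_mul_add_one p).neg_one_pow,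
      sum_range_succ, two_mul]
    push_cast
    ring

lemma tendsto_sum_inv_sub_inv (n : ℕ) (hn : 0 < n) :
    Tendsto (fun N ↦ ∑ M ∈ range N, (if n < 2 * M then
      ((M : ℝ) - n)⁻¹ - (if M = n then 0 else (M : ℝ)⁻¹) else 0)) atTop
      (𝓝 ((2 + (-1) ^ n) / n)) := by
  rw [← tendsto_add_atTop_iff_nat (n + 1)]
  have hpartial (N : ℕ) : ∑ M ∈ range (N + (n + 1)), (if n < 2 * M then
      ((M : ℝ) - n)⁻¹ - (if M = n then 0 else (M : ℝ)⁻¹) else 0)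
      = (2 + (-1) ^ n) / n - ∑ i ∈ range n, ((i : ℝ) + N + 1)⁻¹ := by
    induction N with
    | zero =>
      rw [zero_add, sum_range_succ]
      simp only [sub_self, inv_zero, if_true, ite_self, add_zero, Nat.cast_zero]
      rw [← sum_harmonic_halves n hn]
      refine sum_congr rfl fun M hM ↦ ?_
      rw [if_neg (mem_range.1 hM).ne]
    | succ N ih =>
      have hshift : ∑ i ∈ range n, ((i : ℝ) + (N + 1 : ℕ) + 1)⁻¹
          = ∑ i ∈ range n, ((i : ℝ) + N + 1)⁻¹ + ((n : ℝ) + N + 1)⁻¹ - ((N : ℝ) + 1)⁻¹ := by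
        rw [← sum_range_succ (fun i : ℕ ↦ ((i : ℝ) + N + 1)⁻¹), sum_range_succ', Nat.cast_zero,
          zero_add, add_sub_cancel_right]
        refine sum_congr rfl fun i _ ↦ ?_
        push_cast
        congr 1
        ring
      rw [add_right_comm, sum_range_succ, ih, hshift, if_pos (by omega), if_neg (by omega)]
      push_cast
      rw [show (N : ℝ) + (n + 1) - n = N + 1 by ring, show (N : ℝ) + (n + 1) = n + N + 1 by ring]
      ring
  simp only [hpartial]
  have hlim : Tendsto (fun N : ℕ ↦ ∑ i ∈ range n, ((i : ℝ) + N + 1)⁻¹) atTop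
      (𝓝 (∑ i ∈ range n, 0)) := by
    refine tendsto_finsetSum _ fun i _ ↦ tendsto_inv_atTop_zero.comp ?_
    exact tendsto_atTop_add_const_right _ _
      (tendsto_atTop_add_const_left _ _ tendsto_natCast_atTop_atTop)
  simpa using hlim.const_sub ((2 + (-1 : ℝ) ^ n) / n)

/-- The total of the telescoping part, computed by summing over `M` first. -/
lemma tsum_telescoping (s : ℕ)
    (hsum : Summable fun p : ℕ × ℕ ↦ if 0 < p.2 ∧ p.2 < 2 * p.1 then (-1 : ℝ) ^ p.2 *
      (1 / (p.2 : ℝ) ^ s * (((p.1 : ℝ) - p.2)⁻¹ - (if p.1 = p.2 then 0 else (p.1 : ℝ)⁻¹)))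
      else 0) :
    (∑' p : ℕ × ℕ, if 0 < p.2 ∧ p.2 < 2 * p.1 then (-1 : ℝ) ^ p.2 *
      (1 / (p.2 : ℝ) ^ s * (((p.1 : ℝ) - p.2)⁻¹ - (if p.1 = p.2 then 0 else (p.1 : ℝ)⁻¹)))
      else 0)
      = ∑' n : ℕ, ((-1 : ℝ) ^ (0 * n) / (n : ℝ) ^ (s + 1)
        + 2 * ((-1 : ℝ) ^ (1 * n) / (n : ℝ) ^ (s + 1))) := by
  set f : ℕ × ℕ → ℝ := fun p ↦ if 0 < p.2 ∧ p.2 < 2 * p.1 then (-1 : ℝ) ^ p.2 *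
      (1 / (p.2 : ℝ) ^ s * (((p.1 : ℝ) - p.2)⁻¹ - (if p.1 = p.2 then 0 else (p.1 : ℝ)⁻¹)))
      else 0 with hf
  have hswap : Summable fun p : ℕ × ℕ ↦ f p.swap := hsum.prod_symm
  rw [← (Equiv.prodComm ℕ ℕ).tsum_eq f]
  refine (hswap.tsum_prod (f := fun p : ℕ × ℕ ↦ f p.swap)).trans (tsum_congr fun n ↦ ?_)
  rcases Nat.eq_zero_or_pos n with rfl | hn
  · simp [hf]
  · refine tendsto_nhds_unique (hswap.prod_factor n).hasSum.tendsto_sum_nat ?_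
    have h := (tendsto_sum_inv_sub_inv n hn).const_mul ((-1 : ℝ) ^ n * (1 / (n : ℝ) ^ s))
    have hn' : (n : ℝ) ≠ 0 := by exact_mod_cast hn.ne'
    have hsq : ((-1 : ℝ) ^ n) * (-1) ^ n = 1 := by rw [← mul_pow]; norm_num
    convert h using 2
    · rw [mul_sum]
      refine sum_congr rfl fun M _ ↦ ?_
      simp only [hf, Prod.swap_prod_mk, hn, true_and]
      split_ifs <;> ring
    · rw [zero_mul, one_mul, pow_zero, mul_right_comm, ← mul_div_assoc ((-1 : ℝ) ^ n),
        mul_add, hsq]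
      field_simp
      ring

theorem weighted_sum_level2_mixed (k : ℕ) (hk : 3 ≤ k) :
    ∑ j ∈ Finset.Icc 2 (k - 1), (2 : ℝ) ^ j * altDoubleZeta 0 1 j (k - j)
      + ∑ j ∈ Finset.Icc 2 (k - 1), (2 : ℝ) ^ j * altDoubleZeta 1 1 j (k - j)
      = 2 * altSingleZeta 0 k + 2 * (k : ℝ) * altSingleZeta 1 k := by
  obtain ⟨q, rfl⟩ : ∃ q, k = q + 3 := ⟨k - 3, by omega⟩
  have hF := hasSum_sum fun j (hj : j ∈ Icc 2 (q + 3 - 1)) ↦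
    hasSum_two_pow_mul_altDoubleZeta (j := j) (l := q + 3 - j) (mem_Icc.1 hj).1
      (by have := (mem_Icc.1 hj).2; omega)
  rw [sum_add_distrib] at hF
  have hG := (hasSum_antisymmetric (s := q + 2) (by omega)).mul_left 2
  have hD : HasSum (fun p : ℕ × ℕ ↦ if p.1 = p.2 then
      2 * ((q + 1) * ((-1 : ℝ) ^ (1 * p.2) / (p.2 : ℝ) ^ (q + 3))) else 0)
      (2 * ((q + 1) * altSingleZeta 1 (q + 3))) := by
    have h := ((summable_alt_single 1 (k := q + 3) (by omega)).hasSum.mul_left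
      ((q : ℝ) + 1)).mul_left 2
    rw [← altSingleZeta_eq_tsum _ (by omega)] at h
    have hinj : Function.Injective fun n : ℕ ↦ (n, n) := fun _ _ h ↦ (Prod.ext_iff.1 h).1
    refine (hinj.hasSum_iff ?_).1 (h.congr_fun fun n ↦ by simp)
    rintro ⟨m, n⟩ hx
    exact if_neg fun h ↦ hx ⟨m, by simpa using h⟩
  have hH := ((hF.sub hD).sub hG).mul_left (1 / 2)
  have hH' : HasSum (fun p : ℕ × ℕ ↦ if 0 < p.2 ∧ p.2 < 2 * p.1 then (-1 : ℝ) ^ p.2 *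
      (1 / (p.2 : ℝ) ^ (q + 2) *
        (((p.1 : ℝ) - p.2)⁻¹ - (if p.1 = p.2 then 0 else (p.1 : ℝ)⁻¹))) else 0) _ :=
    hH.congr_fun ?_
  swap
  · rintro ⟨M, n⟩
    simp only
    by_cases hc : 0 < n ∧ n < 2 * M
    · have hM : (M : ℝ) ≠ 0 := by
        have : M ≠ 0 := by omega
        exact_mod_cast this
      have hn : (n : ℝ) ≠ 0 := by
        have : n ≠ 0 := by omega
        exact_mod_cast this
      have hIcc : Icc 2 (q + 3 - 1) = Ico 2 (q + 1 + 2) := by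
        ext; simp only [mem_Icc, mem_Ico]; omega
      have hexp (i : ℕ) : q + 3 - (i + 2) = q + 1 - i := by omega
      simp only [hc, if_true, and_self]
      rw [← mul_sum, ← mul_sum, hIcc, sum_Ico_eq_sum_range, Nat.add_sub_cancel]
      simp only [add_comm 2, hexp]
      rcases eq_or_ne M n with rfl | hne
      · have hconst : ∑ i ∈ range (q + 1), 1 / ((M : ℝ) ^ (i + 2) * (M : ℝ) ^ (q + 1 - i))
            = (q + 1) * (1 / (M : ℝ) ^ (q + 3)) := by
          rw [sum_congr rfl (g := fun _ ↦ 1 / (M : ℝ) ^ (q + 3)) fun i hi ↦ ?_]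
          · simp
          · rw [← pow_add]
            congr 2
            have := mem_range.1 hi
            omega
        rw [hconst]
        simp
        ring
      · rw [sum_one_div_pow_mul_pow hM hn (by exact_mod_cast hne), if_neg hne, if_neg hne]
        ring
    · simp only [hc, if_false, sum_const_zero]
      split_ifs with h
      · have : n = 0 := by omega
        simp [this]
      · simp
  have hT := tsum_telescoping (q + 2) hH'.summable
  rw [hH'.tsum_eq, ((summable_alt_single 0 (by omega)).tsum_add
    ((summable_alt_single 1 (by omega)).mul_left 2)), tsum_mul_left,
    ← altSingleZeta_eq_tsum _ (by omega), ← altSingleZeta_eq_tsum _ (by omega)] at hT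
  rw [Nat.cast_add, Nat.cast_ofNat]
  linarith
end

section
/- For every integer k ≥ 3, Σ_{j=2}^{k−1} ζ₂(j, k−j) = (1/2^{k−2}) ζ(k), where ζ₂(j, k−j) = 4 Σ_{m>n>0, m and n both even} 1/(m^j n^{k−j}). -/
/-- The double zeta value of level 2 with prescribed parities:
`levelTwoDoubleZeta a b j l = 4 Σ_{m>n>0, m≡a, n≡b (mod 2)} 1/(m^j n^l)`. -/
noncomputable def levelTwoDoubleZeta (a b : ℕ) (j l : ℕ) : ℝ :=
  4 * ∑' p : {p : ℕ × ℕ // p.2 < p.1 ∧ 0 < p.2 ∧ p.1 % 2 = a ∧ p.2 % 2 = b},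
    1 / ((p.1.1 : ℝ) ^ j * (p.1.2 : ℝ) ^ l)

/-- The Riemann zeta value as a series. -/
noncomputable def singleZeta (k : ℕ) : ℝ :=
  ∑' m : {m : ℕ // 0 < m}, 1 / (m.1 : ℝ) ^ k

/-- The double zeta summand `1 / (m ^ j * n ^ l)` at `n = p.1 + 1`, `m = n + p.2 + 1`. -/
noncomputable def doubleZetaTerm (j l : ℕ) (p : ℕ × ℕ) : ℝ :=
  1 / (((p.1 : ℝ) + p.2 + 2) ^ j * ((p.1 : ℝ) + 1) ^ l)

/-- Harmonic numbers as real numbers. -/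
noncomputable def realHarmonic (n : ℕ) : ℝ := ∑ i ∈ Finset.range n, 1 / ((i : ℝ) + 1)

lemma doubleZetaTerm_nonneg (j l : ℕ) (p : ℕ × ℕ) : 0 ≤ doubleZetaTerm j l p := by
  unfold doubleZetaTerm
  positivity

lemma realHarmonic_nonneg (n : ℕ) : 0 ≤ realHarmonic n :=
  Finset.sum_nonneg fun _ _ => by positivity

lemma realHarmonic_succ (n : ℕ) : realHarmonic (n + 1) = realHarmonic n + 1 / ((n : ℝ) + 1) :=
  Finset.sum_range_succ _ _

lemma realHarmonic_le_two_mul_sqrt (n : ℕ) : realHarmonic n ≤ 2 * √(n : ℝ) := by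
  induction n with
  | zero => simp [realHarmonic]
  | succ n ih =>
    rw [realHarmonic_succ]
    push_cast
    have h0 : (0 : ℝ) ≤ n := n.cast_nonneg
    set a := √(n : ℝ)
    set b := √((n : ℝ) + 1)
    have ha : 0 ≤ a := Real.sqrt_nonneg _
    have hb : 1 ≤ b := Real.one_le_sqrt.2 (by linarith)
    have ha2 : a ^ 2 = n := Real.sq_sqrt h0
    have hb2 : b ^ 2 = n + 1 := Real.sq_sqrt (by linarith)
    have hab : a ≤ b := Real.sqrt_le_sqrt (by linarith)
    have : 1 / ((n : ℝ) + 1) ≤ 2 * b - 2 * a := by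
      rw [← hb2, div_le_iff₀ (by positivity)]
      have h1 : (b - a) * (b + a) = 1 := by linear_combination hb2 - ha2
      nlinarith [mul_nonneg (sub_nonneg.2 hab) (sub_nonneg.2 hab),
        mul_nonneg (sub_nonneg.2 hab) (sub_nonneg.2 hb),
        mul_nonneg (mul_nonneg (sub_nonneg.2 hab) (by linarith : 0 ≤ b)) (sub_nonneg.2 hb)]
    linarith

lemma summable_realHarmonic_div_pow {s : ℕ} (hs : 2 ≤ s) :
    Summable fun n : ℕ => realHarmonic (n + 1) / ((n : ℝ) + 1) ^ s := by
  have h : Summable fun n : ℕ => 2 * (1 / ((n + 1 : ℕ) : ℝ) ^ (3 / 2 : ℝ)) :=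
    ((summable_nat_add_iff 1).2 (Real.summable_one_div_nat_rpow.2 (by norm_num))).mul_left 2
  refine h.of_nonneg_of_le (fun n => div_nonneg (realHarmonic_nonneg _) (by positivity)) fun n => ?_
  have hn : (1 : ℝ) ≤ (n : ℝ) + 1 := by linarith [(n.cast_nonneg : (0 : ℝ) ≤ n)]
  have hpos : (0 : ℝ) < (n : ℝ) + 1 := by linarith
  have h1 := realHarmonic_le_two_mul_sqrt (n + 1)
  push_cast at h1 ⊢
  calc realHarmonic (n + 1) / ((n : ℝ) + 1) ^ s
      ≤ 2 * √((n : ℝ) + 1) / ((n : ℝ) + 1) ^ 2 := by gcongr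
    _ = 2 * (1 / ((n : ℝ) + 1) ^ (3 / 2 : ℝ)) := by
      have h2 : ((n : ℝ) + 1) ^ 2 = √((n : ℝ) + 1) * ((n : ℝ) + 1) ^ (3 / 2 : ℝ) := by
        rw [Real.sqrt_eq_rpow, ← Real.rpow_add hpos, ← Real.rpow_natCast]
        norm_num
      have h3 : 0 < √((n : ℝ) + 1) := Real.sqrt_pos.2 hpos
      rw [h2]
      field_simp

lemma hasSum_one_div_sub_one_div_add (c : ℕ) :
    HasSum (fun b : ℕ => 1 / ((b : ℝ) + 1) - 1 / ((b : ℝ) + 1 + c)) (realHarmonic c) := by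
  induction c with
  | zero => simp [realHarmonic]
  | succ c ih =>
    have key : HasSum (fun b : ℕ => 1 / ((b : ℝ) + 1 + c) - 1 / ((b : ℝ) + 1 + (c + 1 : ℕ)))
        (1 / ((c : ℝ) + 1)) := by
      rw [hasSum_iff_tendsto_nat_of_nonneg]
      · have h1 (N : ℕ) : ∑ b ∈ Finset.range N,
            (1 / ((b : ℝ) + 1 + c) - 1 / ((b : ℝ) + 1 + (c + 1 : ℕ)))
              = 1 / ((c : ℝ) + 1) - 1 / (((N + c : ℕ) : ℝ) + 1) := by
          have := Finset.sum_range_sub' (fun b : ℕ => 1 / ((b : ℝ) + 1 + c)) N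
          push_cast at this ⊢
          rw [show (1 : ℝ) / (c + 1) = 1 / (0 + 1 + c) by ring_nf,
            show (1 : ℝ) / (N + c + 1) = 1 / (N + 1 + c) by ring_nf, ← this]
          refine Finset.sum_congr rfl fun b _ => ?_
          ring_nf
        simp_rw [h1]
        have h2 := (Filter.tendsto_add_atTop_iff_nat c).2
          (tendsto_one_div_add_atTop_nhds_zero_nat (𝕜 := ℝ))
        simpa using h2.const_sub (1 / ((c : ℝ) + 1))
      · intro b
        rw [sub_nonneg]
        push_cast
        gcongr
        linarith
    rw [realHarmonic_succ]
    simpa only [sub_add_sub_cancel] using ih.add key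

lemma sum_doubleZetaTerm (r : ℕ) (p : ℕ × ℕ) :
    ∑ i ∈ Finset.range r, doubleZetaTerm (2 + i) (r - i) p =
      1 / ((p.1 : ℝ) + 1) ^ (r + 1) * (1 / ((p.2 : ℝ) + 1) - 1 / ((p.2 : ℝ) + 1 + (p.1 + 1 : ℕ)))
        - 1 / (((p.2 : ℝ) + 1) * ((p.1 : ℝ) + p.2 + 2) ^ (r + 1)) := by
  obtain ⟨a, b⟩ := p
  simp only [doubleZetaTerm]
  push_cast
  have hn : (0 : ℝ) < (a : ℝ) + 1 := by positivity
  have hd : (0 : ℝ) < (b : ℝ) + 1 := by positivity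
  have hmn : (a : ℝ) + b + 2 = (a + 1) + (b + 1) := by ring
  have hmn' : (b : ℝ) + 1 + (a + 1) = (a + 1) + (b + 1) := by ring
  rw [hmn, hmn']
  generalize (a : ℝ) + 1 = n at *
  generalize (b : ℝ) + 1 = d at *
  have hg := geom_sum₂_mul (n + d)⁻¹ n⁻¹ r
  have hs : ∑ i ∈ Finset.range r, 1 / ((n + d) ^ (2 + i) * n ^ (r - i)) =
      (1 / ((n + d) ^ 2 * n)) *
        ∑ i ∈ Finset.range r, (n + d)⁻¹ ^ i * n⁻¹ ^ (r - 1 - i) := by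
    rw [Finset.mul_sum]
    refine Finset.sum_congr rfl fun i hi => ?_
    have hi' := Finset.mem_range.1 hi
    rw [show r - i = (r - 1 - i) + 1 by omega, inv_pow, inv_pow, pow_add, pow_succ n]
    field_simp
  have hsub : (n + d)⁻¹ - n⁻¹ = - (d / (n * (n + d))) := by
    field_simp
    ring
  rw [hsub] at hg
  have hg' : ∑ i ∈ Finset.range r, (n + d)⁻¹ ^ i * n⁻¹ ^ (r - 1 - i) =
      (n⁻¹ ^ r - (n + d)⁻¹ ^ r) * (n * (n + d) / d) := by
    have : (n * (n + d) / d) * (d / (n * (n + d))) = 1 := by field_simp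
    linear_combination (-(n * (n + d) / d)) * hg -
      (∑ i ∈ Finset.range r, (n + d)⁻¹ ^ i * n⁻¹ ^ (r - 1 - i)) * this
  rw [hs, hg', inv_pow, inv_pow]
  field_simp
  ring

lemma hasSum_sum_doubleZetaTerm {r : ℕ} (hr : 1 ≤ r) :
    HasSum (fun p : ℕ × ℕ => ∑ i ∈ Finset.range r, doubleZetaTerm (2 + i) (r - i) p)
      (∑' n : ℕ, 1 / ((n : ℝ) + 1) ^ (r + 2)) := by
  set f : ℕ × ℕ → ℝ := fun p => 1 / ((p.1 : ℝ) + 1) ^ (r + 1) *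
    (1 / ((p.2 : ℝ) + 1) - 1 / ((p.2 : ℝ) + 1 + (p.1 + 1 : ℕ))) with hf
  set g : ℕ × ℕ → ℝ := fun p => 1 / (((p.2 : ℝ) + 1) * ((p.1 : ℝ) + p.2 + 2) ^ (r + 1)) with hg
  set A : ℕ → ℝ := fun n => realHarmonic (n + 1) / ((n : ℝ) + 1) ^ (r + 1) with hA
  have hAs : Summable A := summable_realHarmonic_div_pow (by omega)
  have hfg (p : ℕ × ℕ) :
      ∑ i ∈ Finset.range r, doubleZetaTerm (2 + i) (r - i) p = f p - g p :=
    sum_doubleZetaTerm r p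
  have hg0 (p : ℕ × ℕ) : 0 ≤ g p := by simp only [hg]; positivity
  have hgf (p : ℕ × ℕ) : g p ≤ f p :=
    sub_nonneg.1 (hfg p ▸ Finset.sum_nonneg fun _ _ => doubleZetaTerm_nonneg _ _ _)
  have hrow (a : ℕ) : HasSum (fun b => f (a, b)) (A a) := by
    have := (hasSum_one_div_sub_one_div_add (a + 1)).mul_left (1 / ((a : ℝ) + 1) ^ (r + 1))
    rwa [one_div_mul_eq_div] at this
  have hfs : Summable f := by
    rw [summable_prod_of_nonneg fun p => (hg0 p).trans (hgf p)]
    exact ⟨fun a => (hrow a).summable, by simpa only [(hrow _).tsum_eq] using hAs⟩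
  have hft : HasSum f (∑' n, A n) := by
    have := hfs.hasSum
    rwa [hfs.tsum_prod, tsum_congr fun a => (hrow a).tsum_eq] at this
  have hgs : Summable g := hfs.of_nonneg_of_le hg0 hgf
  have hdiag (n : ℕ) : ∑ p ∈ Finset.HasAntidiagonal.antidiagonal n, g p =
      realHarmonic (n + 1) / (((n + 1 : ℕ) : ℝ) + 1) ^ (r + 1) := by
    rw [← Finset.Nat.sum_antidiagonal_swap, Finset.Nat.sum_antidiagonal_eq_sum_range_succ_mk,
      realHarmonic, Finset.sum_div]
    refine Finset.sum_congr rfl fun i hi => ?_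
    have hi' : i ≤ n := Nat.lt_succ_iff.1 (Finset.mem_range.1 hi)
    simp only [hg, Prod.swap]
    rw [Nat.cast_sub hi', div_div]
    push_cast
    ring_nf
  have hgt : HasSum (fun n : ℕ => realHarmonic (n + 1) / (((n + 1 : ℕ) : ℝ) + 1) ^ (r + 1))
      (∑' p, g p) := by
    have h1 : HasSum (g ∘ Finset.HasAntidiagonal.sigmaAntidiagonalEquivProd) (∑' p, g p) :=
      (Equiv.hasSum_iff _).2 hgs.hasSum
    refine h1.sigma fun n => ?_
    rw [← hdiag n]
    exact Finset.hasSum (Finset.HasAntidiagonal.antidiagonal n) g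
  have hgt' : HasSum (fun n : ℕ => realHarmonic n / ((n : ℝ) + 1) ^ (r + 1)) (∑' p, g p) := by
    rw [← hasSum_nat_add_iff' 1]
    simpa [realHarmonic] using hgt
  have hdiff := hAs.hasSum.sub hgt'
  have hterm (n : ℕ) : A n - realHarmonic n / ((n : ℝ) + 1) ^ (r + 1) =
      1 / ((n : ℝ) + 1) ^ (r + 2) := by
    simp only [hA]
    rw [realHarmonic_succ]
    field_simp
    ring
  simp only [hterm] at hdiff
  simp only [hfg]
  rw [hdiff.tsum_eq]
  exact hft.sub hgs.hasSum

/-- Pairs of positive even integers `m > n` correspond to pairs of natural numbers via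
`n = 2 (a + 1)`, `m = 2 (a + b + 2)`. -/
def evenPairEquiv :
    ℕ × ℕ ≃ {p : ℕ × ℕ // p.2 < p.1 ∧ 0 < p.2 ∧ p.1 % 2 = 0 ∧ p.2 % 2 = 0} where
  toFun p := ⟨(2 * (p.1 + p.2 + 2), 2 * (p.1 + 1)), by dsimp only; omega⟩
  invFun q := (q.1.2 / 2 - 1, (q.1.1 - q.1.2) / 2 - 1)
  left_inv p := by
    ext <;> dsimp only <;> omega
  right_inv q := by
    obtain ⟨⟨m, n⟩, h1, h2, h3, h4⟩ := q
    ext <;> dsimp only at * <;> omega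

lemma levelTwoDoubleZeta_zero_zero (j l : ℕ) :
    levelTwoDoubleZeta 0 0 j l = 4 / 2 ^ (j + l) * ∑' p, doubleZetaTerm j l p := by
  rw [levelTwoDoubleZeta, ← evenPairEquiv.tsum_eq, div_mul_eq_mul_div, mul_div_assoc,
    ← tsum_div_const]
  congr 1
  refine tsum_congr fun p => ?_
  simp only [evenPairEquiv, doubleZetaTerm, Equiv.coe_fn_mk]
  push_cast
  rw [mul_pow, mul_pow, pow_add, div_div]
  ring_nf

lemma singleZeta_eq_tsum (k : ℕ) : singleZeta k = ∑' n : ℕ, 1 / ((n : ℝ) + 1) ^ k := by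
  refine (Equiv.pnatEquivNat.symm.tsum_eq fun m : ℕ+ => 1 / ((m : ℕ) : ℝ) ^ k).symm.trans ?_
  simp

theorem sum_formula_level2_zeta (k : ℕ) (hk : 3 ≤ k) :
    ∑ j ∈ Finset.Icc 2 (k - 1), levelTwoDoubleZeta 0 0 j (k - j)
      = (1 / 2 ^ (k - 2)) * singleZeta k := by
  obtain ⟨r, rfl⟩ : ∃ r, k = r + 2 := ⟨k - 2, by omega⟩
  have hsum := hasSum_sum_doubleZetaTerm (r := r) (by omega)
  have hs : ∀ i ∈ Finset.range r, Summable (doubleZetaTerm (2 + i) (r - i)) := fun i hi =>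
    hsum.summable.of_nonneg_of_le (doubleZetaTerm_nonneg _ _) fun p =>
      Finset.single_le_sum (f := fun i => doubleZetaTerm (2 + i) (r - i) p)
        (fun _ _ => doubleZetaTerm_nonneg _ _ _) hi
  have hIcc : Finset.Icc 2 (r + 2 - 1) = Finset.Ico 2 (r + 2) := by
    ext
    simp only [Finset.mem_Icc, Finset.mem_Ico]
    omega
  rw [hIcc, Finset.sum_Ico_eq_sum_range, singleZeta_eq_tsum, ← hsum.tsum_eq,
    Summable.tsum_finsetSum hs, Finset.mul_sum]
  refine Finset.sum_congr rfl fun i hi => ?_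
  have hi' := Finset.mem_range.1 hi
  rw [show r + 2 - (2 + i) = r - i by omega, levelTwoDoubleZeta_zero_zero,
    show 2 + i + (r - i) = r + 2 by omega, Nat.add_sub_cancel, pow_add]
  congr 1
  field_simp
  norm_num
end

section
/- For every integer k ≥ 3, Σ_{j=2}^{k−1} ζ₂(\overline{j}, k−j) = 2 ( ζ^{(2)}(\overline{k−1}, 1) − ζ^{(2)}(\overline{k−1}, \overline{1}) ), where ζ₂(\overline{j}, k−j) = 4 Σ_{m>n>0, m odd, n even} 1/(m^j n^{k−j}), ζ^{(2)}(\overline{k−1}, 1) = Σ_{m>n>0} (−1)^m/(m^{k−1} n) and ζ^{(2)}(\overline{k−1}, \overline{1}) = Σ_{m>n>0} (−1)^{m+n}/(m^{k−1} n). -/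
/-- The pairs `m > n > 0` with `m % 2 = a` and `n % 2 = b`. -/
abbrev ParityPair (a b : ℕ) : Type :=
  {p : ℕ × ℕ // p.2 < p.1 ∧ 0 < p.2 ∧ p.1 % 2 = a ∧ p.2 % 2 = b}

theorem summable_one_div_pow_mul_pow {j l : ℕ} (hj : 2 ≤ j) (hl : 1 ≤ l) :
    Summable fun p : {p : ℕ × ℕ // p.2 < p.1 ∧ 0 < p.2} =>
      1 / ((p.1.1 : ℝ) ^ j * (p.1.2 : ℝ) ^ l) := by
  have h : Summable fun n : ℕ => 1 / (n : ℝ) ^ (3 / 2 : ℝ) :=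
    Real.summable_one_div_nat_rpow.2 (by norm_num)
  have h2 := h.mul_of_nonneg h (fun n => by positivity) (fun n => by positivity)
  refine Summable.of_nonneg_of_le (fun p => by positivity) ?_
    (h2.comp_injective (i := fun p : {p : ℕ × ℕ // p.2 < p.1 ∧ 0 < p.2} => p.1)
      Subtype.val_injective)
  rintro ⟨⟨m, n⟩, hmn, hn⟩
  simp only [Function.comp_apply] at hmn hn ⊢
  have hn1 : (1 : ℝ) ≤ n := by exact_mod_cast hn
  have hnm : (n : ℝ) ≤ m := by exact_mod_cast hmn.le
  have hm1 : (1 : ℝ) ≤ m := hn1.trans hnm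
  have hm0 : (0 : ℝ) < m := by linarith
  have hn0 : (0 : ℝ) < n := by linarith
  rw [one_div_mul_one_div]
  refine one_div_le_one_div_of_le (by positivity) ?_
  calc (m : ℝ) ^ (3 / 2 : ℝ) * (n : ℝ) ^ (3 / 2 : ℝ)
      = (m : ℝ) ^ (3 / 2 : ℝ) * ((n : ℝ) ^ (1 / 2 : ℝ) * n) := by
        rw [← Real.rpow_add_one hn0.ne']; norm_num
    _ ≤ (m : ℝ) ^ (3 / 2 : ℝ) * ((m : ℝ) ^ (1 / 2 : ℝ) * n) := by gcongr
    _ = (m : ℝ) ^ 2 * (n : ℝ) ^ 1 := by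
        rw [← mul_assoc, ← Real.rpow_add hm0, pow_one, ← Real.rpow_natCast]; norm_num
    _ ≤ (m : ℝ) ^ j * (n : ℝ) ^ l := by gcongr

theorem summable_parityPair (a b : ℕ) {j l : ℕ} (hj : 2 ≤ j) (hl : 1 ≤ l) :
    Summable fun p : ParityPair a b => 1 / ((p.1.1 : ℝ) ^ j * (p.1.2 : ℝ) ^ l) := by
  let i : ParityPair a b → {p : ℕ × ℕ // p.2 < p.1 ∧ 0 < p.2} :=
    Subtype.map id fun _ h => ⟨h.1, h.2.1⟩
  have hi : Function.Injective i := Subtype.map_injective _ Function.injective_id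
  exact ((summable_one_div_pow_mul_pow hj hl).comp_injective hi).congr fun p => by
    simp only [i, Function.comp_apply, Subtype.map, id_eq]

/-- The involution `(m, n) ↦ (m, m - n)`, for odd `m`. -/
def oddEvenEquivOddOdd : ParityPair 1 0 ≃ ParityPair 1 1 where
  toFun p := ⟨(p.1.1, p.1.1 - p.1.2), by
    obtain ⟨⟨m, n⟩, h⟩ := p; simp only at h ⊢; omega⟩
  invFun p := ⟨(p.1.1, p.1.1 - p.1.2), by
    obtain ⟨⟨m, n⟩, h⟩ := p; simp only at h ⊢; omega⟩
  left_inv p := by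
    obtain ⟨⟨m, n⟩, h⟩ := p
    simp only at h
    simp only [Subtype.mk.injEq, Prod.mk.injEq, true_and]
    omega
  right_inv p := by
    obtain ⟨⟨m, n⟩, h⟩ := p
    simp only at h
    simp only [Subtype.mk.injEq, Prod.mk.injEq, true_and]
    omega

/-- Parametrization of the pairs `m > n > 0` with `m` odd and `n` even. -/
def prodEquivOddEven : ℕ × ℕ ≃ ParityPair 1 0 where
  toFun x := ⟨(2 * x.1 + 2 + (2 * x.2 + 1), 2 * x.1 + 2), by simp only; omega⟩
  invFun p := (p.1.2 / 2 - 1, (p.1.1 - p.1.2) / 2)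
  left_inv x := by
    obtain ⟨b, c⟩ := x
    simp only [Prod.mk.injEq]
    omega
  right_inv p := by
    obtain ⟨⟨m, n⟩, h⟩ := p
    simp only at h
    simp only [Subtype.mk.injEq, Prod.mk.injEq]
    omega

/-- Parametrization of the pairs `m > n > 0` with `m` even and `n` odd. -/
def sigmaEquivEvenOdd : (Σ b : ℕ, Fin (b + 1)) ≃ ParityPair 0 1 where
  toFun x := ⟨(2 * x.1 + 2, 2 * (x.2 : ℕ) + 1), by have := x.2.2; simp only; omega⟩
  invFun p := ⟨p.1.1 / 2 - 1, ⟨p.1.2 / 2, by have := p.2; omega⟩⟩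
  left_inv x := by
    obtain ⟨b, i, hi⟩ := x
    have hb : (2 * b + 2) / 2 - 1 = b := by omega
    have h : (2 * i + 1) / 2 = i := by omega
    ext
    · exact hb
    · simp only
      rw! [hb, h]
      rfl
  right_inv p := by
    obtain ⟨⟨m, n⟩, h⟩ := p
    simp only at h
    simp only [Subtype.mk.injEq, Prod.mk.injEq]
    omega

theorem hasSum_sub_add_of_antitone {u : ℕ → ℝ} (hu : Antitone u)
    (h0 : Filter.Tendsto u Filter.atTop (nhds 0)) (N : ℕ) :
    HasSum (fun c => u c - u (c + N)) (∑ i ∈ Finset.range N, u i) := by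
  rw [hasSum_iff_tendsto_nat_of_nonneg fun c => sub_nonneg.2 (hu (Nat.le_add_right c N))]
  have key (M : ℕ) : ∑ c ∈ Finset.range M, (u c - u (c + N))
      = ∑ i ∈ Finset.range N, u i - ∑ i ∈ Finset.range N, u (i + M) := by
    have h := (Finset.sum_range_add u M N).symm.trans
      (add_comm M N ▸ Finset.sum_range_add u N M)
    have hN : ∑ c ∈ Finset.range M, u (c + N) = ∑ c ∈ Finset.range M, u (N + c) :=
      Finset.sum_congr rfl fun c _ => by rw [add_comm]
    have hM : ∑ i ∈ Finset.range N, u (i + M) = ∑ i ∈ Finset.range N, u (M + i) :=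
      Finset.sum_congr rfl fun i _ => by rw [add_comm]
    rw [Finset.sum_sub_distrib, hN, hM]
    linarith
  simp only [key]
  have hlim : Filter.Tendsto (fun M => ∑ i ∈ Finset.range N, u (i + M)) Filter.atTop
      (nhds (∑ _i ∈ Finset.range N, (0 : ℝ))) :=
    tendsto_finsetSum _ fun i _ => by
      simpa only [add_comm i] using (Filter.tendsto_add_atTop_iff_nat i).2 h0
  simpa using hlim.const_sub (∑ i ∈ Finset.range N, u i)

theorem hasSum_one_div_odd_mul_odd (N : ℕ) (hN : 0 < N) :
    HasSum (fun c : ℕ => 1 / ((2 * N + (2 * c + 1) : ℝ) * (2 * c + 1)))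
      (1 / (2 * N) * ∑ i ∈ Finset.range N, 1 / (2 * i + 1 : ℝ)) := by
  have hanti : Antitone fun c : ℕ => 1 / (2 * c + 1 : ℝ) := fun a b hab => by
    have : (a : ℝ) ≤ b := by exact_mod_cast hab
    exact one_div_le_one_div_of_le (by positivity) (by linarith)
  have hlim : Filter.Tendsto (fun c : ℕ => 1 / (2 * c + 1 : ℝ)) Filter.atTop (nhds 0) := by
    have h := (tendsto_one_div_add_atTop_nhds_zero_nat (𝕜 := ℝ))
    refine squeeze_zero (fun c => by positivity) (fun c => ?_) h
    have : (0 : ℝ) ≤ c := c.cast_nonneg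
    exact one_div_le_one_div_of_le (by positivity) (by linarith)
  refine ((hasSum_sub_add_of_antitone hanti hlim N).mul_left (1 / (2 * N : ℝ))).congr_fun fun c => ?_
  have : (0 : ℝ) < N := by exact_mod_cast hN
  push_cast
  field_simp
  ring

theorem tsum_oddEven_eq_tsum_evenOdd {r : ℕ} (hr : 1 ≤ r)
    (hs : Summable fun p : ParityPair 1 0 =>
      1 / ((p.1.1 : ℝ) * (p.1.2 : ℝ) ^ r * (p.1.1 - p.1.2))) :
    ∑' p : ParityPair 1 0, 1 / ((p.1.1 : ℝ) * (p.1.2 : ℝ) ^ r * (p.1.1 - p.1.2))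
      = ∑' p : ParityPair 0 1, 1 / ((p.1.1 : ℝ) ^ (r + 1) * (p.1.2 : ℝ) ^ 1) := by
  have hs' := summable_parityPair 0 1 (j := r + 1) (l := 1) (by omega) le_rfl
  refine (prodEquivOddEven.tsum_eq _).symm.trans (Eq.trans ?_ (sigmaEquivEvenOdd.tsum_eq _))
  refine (Summable.tsum_prod (prodEquivOddEven.summable_iff.2 hs)).trans
    (Eq.trans ?_ (Summable.tsum_sigma (sigmaEquivEvenOdd.summable_iff.2 hs')).symm)
  refine tsum_congr fun b => ?_
  have h := (hasSum_one_div_odd_mul_odd (b + 1) b.succ_pos).mul_left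
    (1 / (2 * (b + 1 : ℕ) : ℝ) ^ r)
  refine Eq.trans (tsum_congr fun c => ?_)
    (h.tsum_eq.trans (Eq.trans ?_ (tsum_fintype _).symm))
  · simp only [prodEquivOddEven, Function.comp_apply, Equiv.coe_fn_mk]
    push_cast
    rw [one_div_mul_one_div]
    congr 1
    ring
  · rw [Finset.sum_range, ← mul_assoc, Finset.mul_sum]
    refine Finset.sum_congr rfl fun i _ => ?_
    simp only [sigmaEquivEvenOdd, Function.comp_apply, Equiv.coe_fn_mk]
    push_cast
    rw [one_div_mul_one_div, one_div_mul_one_div]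
    congr 1
    ring

theorem sum_one_div_pow_mul_pow_s16 {x y : ℝ} (hx : x ≠ 0) (hy : y ≠ 0) (hxy : x - y ≠ 0) (r : ℕ) :
    ∑ j ∈ Finset.Icc 2 (r + 1), 1 / (x ^ j * y ^ (r + 2 - j))
      = 1 / (x * y ^ r * (x - y)) - 1 / (x ^ (r + 1) * (x - y)) := by
  induction r with
  | zero => simp
  | succ r ih =>
    have h : ∑ j ∈ Finset.Icc 2 (r + 1), 1 / (x ^ j * y ^ (r + 1 + 2 - j))
        = (∑ j ∈ Finset.Icc 2 (r + 1), 1 / (x ^ j * y ^ (r + 2 - j))) * (1 / y) := by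
      rw [Finset.sum_mul]
      refine Finset.sum_congr rfl fun j hj => ?_
      have := (Finset.mem_Icc.1 hj).2
      rw [show r + 1 + 2 - j = r + 2 - j + 1 by omega, one_div_mul_one_div, pow_succ, mul_assoc]
    rw [Finset.sum_Icc_succ_top (by omega), h, ih, show r + 1 + 2 - (r + 1 + 1) = 1 by omega]
    field_simp
    ring

theorem sum_levelTwoDoubleZeta {r : ℕ} (hr : 1 ≤ r) :
    ∑ j ∈ Finset.Icc 2 (r + 1), levelTwoDoubleZeta 1 0 j (r + 2 - j)
      = levelTwoDoubleZeta 0 1 (r + 1) 1 - levelTwoDoubleZeta 1 1 (r + 1) 1 := by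
  have hterm (p : ParityPair 1 0) :
      ∑ j ∈ Finset.Icc 2 (r + 1), 1 / ((p.1.1 : ℝ) ^ j * (p.1.2 : ℝ) ^ (r + 2 - j))
        = 1 / ((p.1.1 : ℝ) * (p.1.2 : ℝ) ^ r * (p.1.1 - p.1.2))
          - 1 / ((p.1.1 : ℝ) ^ (r + 1) * (p.1.1 - p.1.2)) := by
    obtain ⟨⟨m, n⟩, hmn, hn, -⟩ := p
    simp only at hmn hn ⊢
    have h1 : (0 : ℝ) < n := by exact_mod_cast hn
    have h2 : (n : ℝ) < m := by exact_mod_cast hmn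
    exact sum_one_div_pow_mul_pow_s16 (by linarith) h1.ne' (sub_pos.2 h2).ne' r
  have hsum (j : ℕ) (hj : j ∈ Finset.Icc 2 (r + 1)) :=
    summable_parityPair 1 0 (Finset.mem_Icc.1 hj).1
      (show 1 ≤ r + 2 - j by have := (Finset.mem_Icc.1 hj).2; omega)
  have hG (p : ParityPair 1 0) : 1 / ((p.1.1 : ℝ) ^ (r + 1) * (p.1.1 - p.1.2))
      = 1 / (((oddEvenEquivOddOdd p).1.1 : ℝ) ^ (r + 1)
        * ((oddEvenEquivOddOdd p).1.2 : ℝ) ^ 1) := by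
    simp only [oddEvenEquivOddOdd, Equiv.coe_fn_mk, pow_one, Nat.cast_sub p.2.1.le]
  have hGs : Summable fun p : ParityPair 1 0 =>
      1 / ((p.1.1 : ℝ) ^ (r + 1) * (p.1.1 - p.1.2)) := by
    simp only [hG]
    exact oddEvenEquivOddOdd.summable_iff.2
      (summable_parityPair 1 1 (j := r + 1) (by omega) le_rfl)
  have hFs : Summable fun p : ParityPair 1 0 =>
      1 / ((p.1.1 : ℝ) * (p.1.2 : ℝ) ^ r * (p.1.1 - p.1.2)) := by
    refine ((summable_sum hsum).add hGs).congr fun p => ?_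
    rw [hterm]
    ring
  simp only [levelTwoDoubleZeta]
  rw [← Finset.mul_sum, ← Summable.tsum_finsetSum hsum, tsum_congr hterm, hFs.tsum_sub hGs,
    tsum_oddEven_eq_tsum_evenOdd hr hFs, tsum_congr hG, mul_sub]
  congr 2
  exact oddEvenEquivOddOdd.tsum_eq fun p : ParityPair 1 1 =>
    1 / ((p.1.1 : ℝ) ^ (r + 1) * (p.1.2 : ℝ) ^ 1)

theorem tsum_parityPair_eq_tsum_ite (a b : ℕ) (f : ℕ × ℕ → ℝ) :
    ∑' p : ParityPair a b, f p.1
      = ∑' p : {p : ℕ × ℕ // p.2 < p.1 ∧ 0 < p.2},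
          if p.1.1 % 2 = a ∧ p.1.2 % 2 = b then f p.1 else 0 := by
  have h1 := tsum_subtype {p : ℕ × ℕ | p.2 < p.1 ∧ 0 < p.2 ∧ p.1 % 2 = a ∧ p.2 % 2 = b} f
  have h2 := tsum_subtype {p : ℕ × ℕ | p.2 < p.1 ∧ 0 < p.2}
    fun p => if p.1 % 2 = a ∧ p.2 % 2 = b then f p else 0
  refine h1.trans (Eq.trans (tsum_congr fun p => ?_) h2.symm)
  simp only [Set.indicator_apply, Set.mem_ofPred_eq, ← ite_and, and_assoc]

theorem altDoubleZeta_sub {j : ℕ} (hj : 2 ≤ j) :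
    2 * (altDoubleZeta 1 0 j 1 - altDoubleZeta 1 1 j 1)
      = levelTwoDoubleZeta 0 1 j 1 - levelTwoDoubleZeta 1 1 j 1 := by
  have hs := summable_one_div_pow_mul_pow hj le_rfl
  have hsign (a b : ℕ) : Summable fun p : {p : ℕ × ℕ // p.2 < p.1 ∧ 0 < p.2} =>
      (-1 : ℝ) ^ (a * p.1.1 + b * p.1.2) / ((p.1.1 : ℝ) ^ j * (p.1.2 : ℝ) ^ 1) := by
    refine Summable.of_norm (hs.congr fun p => ?_)
    simp
  have hite (a b : ℕ) : Summable fun p : {p : ℕ × ℕ // p.2 < p.1 ∧ 0 < p.2} =>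
      if p.1.1 % 2 = a ∧ p.1.2 % 2 = b then 1 / ((p.1.1 : ℝ) ^ j * (p.1.2 : ℝ) ^ 1) else 0 := by
    refine Summable.of_nonneg_of_le (fun p => ?_) (fun p => ?_) hs
    · split_ifs <;> positivity
    · split_ifs
      · exact le_rfl
      · positivity
  simp only [levelTwoDoubleZeta, altDoubleZeta]
  rw [tsum_parityPair_eq_tsum_ite 0 1 fun p => 1 / ((p.1 : ℝ) ^ j * (p.2 : ℝ) ^ 1),
    tsum_parityPair_eq_tsum_ite 1 1 fun p => 1 / ((p.1 : ℝ) ^ j * (p.2 : ℝ) ^ 1),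
    ← (hsign 1 0).tsum_sub (hsign 1 1), ← mul_sub, ← (hite 0 1).tsum_sub (hite 1 1),
    ← tsum_mul_left, ← tsum_mul_left]
  refine tsum_congr fun p => ?_
  obtain ⟨⟨m, n⟩, -⟩ := p
  rcases Nat.even_or_odd m with hm | hm <;> rcases Nat.even_or_odd n with hn | hn <;>
    have hm' := hm <;> have hn' := hn <;>
    simp only [Nat.even_iff, Nat.odd_iff] at hm' hn' <;>
    simp [pow_add, hm.neg_one_pow, hn.neg_one_pow, hm', hn'] <;> ring

theorem sum_formula_level2_zeta_bar_unbar (k : ℕ) (hk : 3 ≤ k) :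
    ∑ j ∈ Finset.Icc 2 (k - 1), levelTwoDoubleZeta 1 0 j (k - j)
      = 2 * (altDoubleZeta 1 0 (k - 1) 1 - altDoubleZeta 1 1 (k - 1) 1) := by
  obtain ⟨r, rfl⟩ : ∃ r, k = r + 2 := ⟨k - 2, by omega⟩
  rw [show r + 2 - 1 = r + 1 by omega, altDoubleZeta_sub (by omega),
    sum_levelTwoDoubleZeta (by omega)]
end

section
/- For every integer k ≥ 3, Σ_{j=2}^{k−1} 2^{j} ζ₂(j, k−j) = ((k+1)/2^{k−2}) ζ(k), where ζ₂(j, k−j) = 4 Σ_{m>n>0, m and n both even} 1/(m^j n^{k−j}). -/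
/-- The part of `∑ j, (2 / m) ^ j * (1 / n) ^ (d + 2 - j)` with a power of `m` as denominator,
off the line `m = 2 n`. -/
noncomputable def antisymmPart (d : ℕ) (p : ℕ × ℕ) : ℝ :=
  if p.2 < p.1 ∧ 0 < p.2 then 4 / (p.1 * (2 * p.2 - p.1)) * (2 / p.1) ^ d else 0

/-- The part of `∑ j, (2 / m) ^ j * (1 / n) ^ (d + 2 - j)` with a power of `n` as denominator,
off the line `m = 2 n`. -/
noncomputable def telescopingPart (d : ℕ) (p : ℕ × ℕ) : ℝ :=
  if p.2 < p.1 ∧ 0 < p.2 then 4 / (p.1 * (p.1 - 2 * p.2)) * (1 / p.2) ^ d else 0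

/-- The contribution of the line `m = 2 n`. -/
noncomputable def diagonalPart (k : ℕ) (p : ℕ × ℕ) : ℝ :=
  if p.1 = 2 * p.2 ∧ 0 < p.2 then 1 / (p.2 : ℝ) ^ k else 0

/-- The summand of the (ordinary) double zeta value `ζ(j, l)`, weighted by `2 ^ j`. -/
noncomputable def weightedSummand (j l : ℕ) (p : ℕ × ℕ) : ℝ :=
  if p.2 < p.1 ∧ 0 < p.2 then (2 / p.1) ^ j * (1 / p.2) ^ l else 0

theorem weightedSummand_nonneg (j l : ℕ) (p : ℕ × ℕ) : 0 ≤ weightedSummand j l p := by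
  unfold weightedSummand
  split_ifs <;> positivity

theorem sum_Icc_pow_mul_pow {x y : ℝ} (d : ℕ) :
    (x - y) * ∑ j ∈ Finset.Icc 2 (d + 1), x ^ j * y ^ (d + 2 - j)
      = x ^ 2 * y * (x ^ d - y ^ d) := by
  have h : ∑ j ∈ Finset.Icc 2 (d + 1), x ^ j * y ^ (d + 2 - j)
      = x ^ 2 * y * ∑ i ∈ Finset.range d, x ^ i * y ^ (d - 1 - i) := by
    rw [← Finset.Ico_add_one_right_eq_Icc, Finset.sum_Ico_eq_sum_range, Finset.mul_sum]
    refine Finset.sum_congr (by congr 1) fun i hi => ?_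
    have hi' : i < d := Finset.mem_range.1 hi
    rw [show d + 2 - (2 + i) = (d - 1 - i) + 1 by omega]
    ring
  rw [h, mul_left_comm, mul_comm (x - y), geom_sum₂_mul]

theorem sum_weightedSummand (d : ℕ) (p : ℕ × ℕ) :
    ∑ j ∈ Finset.Icc 2 (d + 1), weightedSummand j (d + 2 - j) p
      = d * diagonalPart (d + 2) p + antisymmPart d p + telescopingPart d p := by
  obtain ⟨m, n⟩ := p
  unfold weightedSummand diagonalPart antisymmPart telescopingPart
  by_cases h : n < m ∧ 0 < n
  · have hn : (0 : ℝ) < n := by exact_mod_cast h.2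
    have hm : (0 : ℝ) < m := by exact_mod_cast h.2.trans h.1
    simp only [h, and_self, if_true, and_true]
    by_cases hmn : m = 2 * n
    · subst hmn
      have h2 : (2 : ℝ) / ((2 * n : ℕ) : ℝ) = 1 / n := by push_cast; field_simp
      have h3 : ∀ j ∈ Finset.Icc 2 (d + 1),
          (1 / (n : ℝ)) ^ j * (1 / (n : ℝ)) ^ (d + 2 - j) = 1 / (n : ℝ) ^ (d + 2) := by
        intro j hj
        have := Finset.mem_Icc.1 hj
        rw [← pow_add, show j + (d + 2 - j) = d + 2 by omega, one_div_pow]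
      rw [h2, Finset.sum_congr rfl h3]
      simp
    · have hne : (m : ℝ) - 2 * n ≠ 0 := by
        rw [sub_ne_zero]; exact_mod_cast hmn
      have hne' : 2 * (n : ℝ) - m ≠ 0 := fun h => hne (by linarith)
      have hxy : (2 : ℝ) / m - 1 / n ≠ 0 := by
        have : (2 : ℝ) / m - 1 / n = (2 * n - m) / (m * n) := by field_simp
        rw [this]; positivity
      apply mul_left_cancel₀ hxy
      rw [sum_Icc_pow_mul_pow, if_neg hmn]
      generalize ((2 : ℝ) / m) ^ d = X
      generalize ((1 : ℝ) / n) ^ d = Y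
      rw [show (m : ℝ) - 2 * n = -(2 * n - m) by ring]
      field_simp
      ring
  · simp only [h, if_false, Finset.sum_const_zero]
    rw [if_neg (by omega)]
    simp

theorem abs_antisymmPart_le (d : ℕ) (p : ℕ × ℕ) :
    |antisymmPart d p| ≤ 2 ^ d * |telescopingPart d p| := by
  obtain ⟨m, n⟩ := p
  unfold antisymmPart telescopingPart
  dsimp only
  split_ifs with h
  · have hn : (0 : ℝ) < n := by exact_mod_cast h.2
    have hnm : (n : ℝ) ≤ m := by exact_mod_cast h.1.le
    have hm := hn.trans_le hnm
    rw [show 4 / ((m : ℝ) * (2 * n - m)) = -(4 / ((m : ℝ) * (m - 2 * n))) by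
      rw [← div_neg]; ring_nf, abs_mul, abs_mul, abs_neg, mul_left_comm]
    refine mul_le_mul_of_nonneg_left ?_ (abs_nonneg _)
    rw [abs_of_nonneg (by positivity), abs_of_nonneg (by positivity), ← mul_pow]
    gcongr
    rw [mul_one_div]
    gcongr
  · simp

theorem inv_mul_mul_le_rpow {m n r : ℝ} (hn : 0 < n) (hr : 0 < r) (hnm : n ≤ m) (hrm : r ≤ m) :
    1 / (m * r * n) ≤ n ^ (-(3 / 2) : ℝ) * r ^ (-(3 / 2) : ℝ) := by
  have key : ∀ x : ℝ, 0 < x → x ^ (-(3 / 2) : ℝ) = 1 / (x * √x) := by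
    intro x hx
    rw [Real.rpow_neg hx.le, one_div, Real.sqrt_eq_rpow, ← Real.rpow_one_add' hx.le (by norm_num)]
    norm_num
  rw [key n hn, key r hr, div_mul_div_comm, one_mul]
  have h : √n * √r ≤ m := by
    have h1 := Real.sqrt_le_sqrt hnm
    have h2 := Real.sqrt_le_sqrt hrm
    calc √n * √r ≤ √m * √m := by gcongr
      _ = m := Real.mul_self_sqrt (hn.le.trans hnm)
  have := Real.sqrt_pos.2 hn
  have := Real.sqrt_pos.2 hr
  apply one_div_le_one_div_of_le (by positivity)
  nlinarith [mul_le_mul_of_nonneg_left h (mul_pos hn hr).le]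

theorem summable_telescopingPart {d : ℕ} (hd : 1 ≤ d) : Summable (telescopingPart d) := by
  have h1 : Summable fun n : ℕ => (n : ℝ) ^ (-(3 / 2) : ℝ) :=
    Real.summable_nat_rpow.2 (by norm_num)
  have h2 : Summable fun r : ℤ => |(r : ℝ)| ^ (-(3 / 2) : ℝ) :=
    Real.summable_abs_int_rpow (by norm_num)
  have h3 := (h1.mul_of_nonneg h2 (fun n => by positivity) (fun r => by positivity))
  have hinj : Function.Injective fun p : ℕ × ℕ => ((p.2, (p.1 : ℤ) - 2 * p.2) : ℕ × ℤ) := by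
    rintro ⟨m, n⟩ ⟨m', n'⟩ h
    simp only [Prod.mk.injEq] at h ⊢
    omega
  refine Summable.of_norm_bounded ((h3.comp_injective hinj).mul_left 4) ?_
  rintro ⟨m, n⟩
  simp only [Function.comp_apply, Real.norm_eq_abs, telescopingPart]
  split_ifs with h
  · by_cases hmn : m = 2 * n
    · subst hmn
      simp only [Nat.cast_mul, Nat.cast_ofNat, sub_self, mul_zero, div_zero, zero_mul, abs_zero]
      positivity
    have hn : (1 : ℝ) ≤ n := by exact_mod_cast h.2
    have hnm : (n : ℝ) ≤ m := by exact_mod_cast h.1.le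
    have hne : (m : ℝ) - 2 * n ≠ 0 := by rw [sub_ne_zero]; exact_mod_cast hmn
    have hr : 0 < |(m : ℝ) - 2 * n| := abs_pos.2 hne
    have hrm : |(m : ℝ) - 2 * n| ≤ m := abs_le.2 ⟨by linarith, by linarith⟩
    have hb := inv_mul_mul_le_rpow (by linarith) hr hnm hrm
    have hp : (1 / (n : ℝ)) ^ d ≤ 1 / n := by
      refine pow_le_of_le_one (by positivity) ?_ (by omega)
      rw [div_le_one (by linarith)]; exact hn
    rw [abs_mul, abs_div, abs_mul, abs_of_nonneg (show (0 : ℝ) ≤ m by positivity),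
      abs_of_nonneg (show (0 : ℝ) ≤ 4 by norm_num),
      abs_of_nonneg (show (0 : ℝ) ≤ (1 / (n : ℝ)) ^ d by positivity)]
    push_cast
    calc 4 / (m * |(m : ℝ) - 2 * n|) * (1 / n) ^ d ≤ 4 / (m * |(m : ℝ) - 2 * n|) * (1 / n) := by
          gcongr
      _ = 4 * (1 / (m * |(m : ℝ) - 2 * n| * n)) := by field_simp
      _ ≤ _ := by gcongr
  · rw [abs_zero]; positivity

theorem summable_antisymmPart {d : ℕ} (hd : 1 ≤ d) : Summable (antisymmPart d) :=
  Summable.of_norm_bounded ((summable_telescopingPart hd).abs.mul_left (2 ^ d))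
    (abs_antisymmPart_le d)

theorem tsum_antisymmPart {d : ℕ} (hd : 1 ≤ d) : ∑' p, antisymmPart d p = 0 := by
  rw [(summable_antisymmPart hd).tsum_prod]
  refine (tsum_congr fun m => ?_).trans tsum_zero
  rw [tsum_eq_sum (s := Finset.range (m + 1))]
  · have h := Finset.sum_range_reflect (fun n => antisymmPart d (m, n)) (m + 1)
    have h' : ∑ n ∈ Finset.range (m + 1), antisymmPart d (m, m + 1 - 1 - n)
        = -∑ n ∈ Finset.range (m + 1), antisymmPart d (m, n) := by
      rw [← Finset.sum_neg_distrib]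
      refine Finset.sum_congr rfl fun n hn => ?_
      have hn' : n ≤ m := Nat.lt_succ_iff.1 (Finset.mem_range.1 hn)
      simp only [antisymmPart, Nat.add_sub_cancel]
      by_cases hc : n < m ∧ 0 < n
      · rw [if_pos hc, if_pos (by omega), Nat.cast_sub hn', ← neg_mul, ← div_neg]
        ring_nf
      · rw [if_neg hc, if_neg (by omega), neg_zero]
    linarith
  · intro n hn
    rw [Finset.mem_range] at hn
    exact if_neg (by dsimp only; omega)

theorem sum_range_telescopingPart (d q N : ℕ) :
    ∑ m ∈ Finset.range (2 * (q + 1) + 1 + N), telescopingPart d (m, q + 1)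
      = 2 * (1 / (q + 1 : ℝ)) ^ (d + 1) *
        (3 / (2 * (q + 1)) - ∑ i ∈ Finset.range (2 * (q + 1)), 1 / ((N : ℝ) + i + 1)) := by
  induction N with
  | zero =>
    rw [show 2 * (q + 1) + 1 + 0 = (q + 2) + q + 1 by ring, Finset.sum_range_succ,
      Finset.sum_range_add, Finset.sum_eq_zero (s := Finset.range (q + 2))]
    swap
    · intro m hm
      rw [Finset.mem_range] at hm
      exact if_neg (by dsimp only; omega)
    have hlast : telescopingPart d (q + 2 + q, q + 1) = 0 := by
      simp only [telescopingPart]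
      rw [if_pos (by omega)]
      push_cast
      rw [show (q : ℝ) + 2 + q - 2 * (q + 1) = 0 by ring]
      simp
    have hterm : ∀ i ∈ Finset.range q, telescopingPart d (q + 2 + i, q + 1)
        = 2 * (1 / (q + 1 : ℝ)) ^ (d + 1) *
          (-(1 / ((q - 1 - i : ℕ) + 1 : ℝ)) - 1 / ((q : ℝ) + 1 + i + 1)) := by
      intro i hi
      have hi' := Finset.mem_range.1 hi
      obtain ⟨t, rfl⟩ : ∃ t, q = i + 1 + t := ⟨q - 1 - i, by omega⟩
      simp only [telescopingPart]
      rw [if_pos (by omega), show i + 1 + t - 1 - i = t by omega]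
      push_cast
      rw [show (i : ℝ) + 1 + t + 2 + i - 2 * (i + 1 + t + 1) = -(t + 1) by ring, pow_succ]
      field_simp
      ring
    have hrefl := Finset.sum_range_reflect (fun i => 1 / ((i : ℕ) + 1 : ℝ)) q
    rw [hlast, Finset.sum_congr rfl hterm, ← Finset.mul_sum, Finset.sum_sub_distrib,
      Finset.sum_neg_distrib, hrefl, show 2 * (q + 1) = (q + 1) + q + 1 by ring,
      Finset.sum_range_succ _ (q + 1 + q), Finset.sum_range_add, Finset.sum_range_succ _ q]
    push_cast
    simp only [zero_add]
    have e : (3 : ℝ) / (2 * (q + 1)) = 1 / (q + 1) + 1 / (q + 1 + q + 1) := by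
      field_simp; ring
    rw [e]
    ring
  | succ N ih =>
    rw [← add_assoc, Finset.sum_range_succ, ih]
    have h1 : telescopingPart d (2 * (q + 1) + 1 + N, q + 1) = 2 * (1 / (q + 1 : ℝ)) ^ (d + 1) *
        (1 / ((N : ℝ) + 1) - 1 / (N + (2 * (q + 1) : ℕ) + 1)) := by
      simp only [telescopingPart]
      rw [if_pos (by omega), pow_succ]
      push_cast
      rw [show 2 * ((q : ℝ) + 1) + 1 + N - 2 * (q + 1) = N + 1 by ring]
      field_simp
      ring
    have h2 := Finset.sum_range_succ (fun i : ℕ => 1 / ((N : ℝ) + i + 1)) (2 * (q + 1))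
    rw [Finset.sum_range_succ'] at h2
    have h3 : ∑ i ∈ Finset.range (2 * (q + 1)), 1 / (((N + 1 : ℕ) : ℝ) + i + 1)
        = ∑ i ∈ Finset.range (2 * (q + 1)), 1 / ((N : ℝ) + (i + 1 : ℕ) + 1) :=
      Finset.sum_congr rfl fun i _ => by push_cast; ring_nf
    rw [h1, h3, ← mul_add]
    congr 1
    simp only [Nat.cast_zero, add_zero] at h2
    linarith

theorem tsum_telescopingPart_fst {d : ℕ} (hd : 1 ≤ d) (q : ℕ) :
    ∑' m, telescopingPart d (m, q + 1) = 3 * (1 / ((q + 1 : ℕ) : ℝ) ^ (d + 2)) := by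
  have hs : Summable fun m => telescopingPart d (m, q + 1) :=
    (summable_telescopingPart hd).comp_injective (i := fun m => (m, q + 1))
      fun a b h => (Prod.mk.inj h).1
  have ht := (Filter.tendsto_add_atTop_iff_nat (2 * (q + 1) + 1)).2 hs.hasSum.tendsto_sum_nat
  simp only [add_comm _ (2 * (q + 1) + 1), sum_range_telescopingPart] at ht
  have h0 : Filter.Tendsto
      (fun N : ℕ => ∑ i ∈ Finset.range (2 * (q + 1)), 1 / ((N : ℝ) + i + 1))
      Filter.atTop (nhds 0) := by
    rw [← Finset.sum_const_zero (s := Finset.range (2 * (q + 1)))]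
    refine tendsto_finsetSum _ fun i _ => ?_
    have := (Filter.tendsto_add_atTop_iff_nat i).2
      (tendsto_one_div_add_atTop_nhds_zero_nat (𝕜 := ℝ))
    simpa using this
  have h1 := (h0.const_sub (3 / (2 * ((q : ℝ) + 1)))).const_mul
    (2 * (1 / ((q : ℝ) + 1)) ^ (d + 1))
  rw [tendsto_nhds_unique ht h1, one_div_pow, pow_succ _ (d + 1)]
  push_cast
  field_simp
  ring

theorem tsum_succ_eq_tsum (f : ℕ → ℝ) (hf : f 0 = 0) : ∑' n, f (n + 1) = ∑' n, f n := by
  refine (add_left_injective 1).tsum_eq (f := f) fun n hn => ?_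
  obtain _ | n := n
  · exact absurd hf hn
  · exact ⟨n, rfl⟩

theorem singleZeta_eq_tsum_succ (k : ℕ) : singleZeta k = ∑' n : ℕ, 1 / ((n + 1 : ℕ) : ℝ) ^ k :=
  (Equiv.tsum_eq Equiv.pnatEquivNat.symm fun m : {m : ℕ // 0 < m} => 1 / (m.1 : ℝ) ^ k).symm

theorem tsum_telescopingPart {d : ℕ} (hd : 1 ≤ d) :
    ∑' p, telescopingPart d p = 3 * singleZeta (d + 2) := by
  have hs : Summable fun p : ℕ × ℕ => telescopingPart d p.swap :=
    (summable_telescopingPart hd).comp_injective Prod.swap_injective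
  calc ∑' p, telescopingPart d p = ∑' p : ℕ × ℕ, telescopingPart d p.swap :=
        ((Equiv.prodComm ℕ ℕ).tsum_eq (telescopingPart d)).symm
    _ = ∑' n, ∑' m, telescopingPart d (m, n) := hs.tsum_prod
    _ = ∑' q, ∑' m, telescopingPart d (m, q + 1) :=
        (tsum_succ_eq_tsum (fun n => ∑' m, telescopingPart d (m, n))
          (by simp [telescopingPart])).symm
    _ = 3 * singleZeta (d + 2) := by
        rw [tsum_congr (tsum_telescopingPart_fst hd), tsum_mul_left, singleZeta_eq_tsum_succ]

theorem hasSum_diagonalPart {k : ℕ} (hk : 2 ≤ k) : HasSum (diagonalPart k) (singleZeta k) := by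
  have hinj : Function.Injective fun n : ℕ => ((2 * (n + 1), n + 1) : ℕ × ℕ) := by
    intro a b h
    simp only [Prod.mk.injEq] at h
    omega
  rw [singleZeta_eq_tsum_succ, ← hinj.hasSum_iff]
  · have hs : Summable fun n : ℕ => 1 / ((n + 1 : ℕ) : ℝ) ^ k :=
      (summable_nat_add_iff 1).2 (Real.summable_one_div_nat_pow.2 hk)
    convert hs.hasSum using 2 with n
    simp [diagonalPart]
  · rintro ⟨m, n⟩ h
    refine if_neg fun hc => h ⟨n - 1, ?_⟩
    simp only [Prod.mk.injEq] at hc ⊢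
    omega

theorem tsum_weightedSummand (j l : ℕ) :
    2 ^ j * levelTwoDoubleZeta 0 0 j l = 4 / 2 ^ (j + l) * ∑' p, weightedSummand j l p := by
  have hinj : Function.Injective fun p : ℕ × ℕ => ((2 * p.1, 2 * p.2) : ℕ × ℕ) := by
    rintro ⟨m, n⟩ ⟨m', n'⟩ h
    simp only [Prod.mk.injEq] at h ⊢
    omega
  have h := tsum_subtype {p : ℕ × ℕ | p.2 < p.1 ∧ 0 < p.2 ∧ p.1 % 2 = 0 ∧ p.2 % 2 = 0}
    fun p => 1 / ((p.1 : ℝ) ^ j * (p.2 : ℝ) ^ l)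
  rw [levelTwoDoubleZeta]
  erw [h]
  rw [← hinj.tsum_eq, ← tsum_mul_left, ← tsum_mul_left, ← tsum_mul_left]
  · refine tsum_congr fun ⟨m, n⟩ => ?_
    simp only [Set.indicator_apply, Set.mem_ofPred_eq, weightedSummand]
    by_cases hc : n < m ∧ 0 < n
    · rw [if_pos hc, if_pos (by omega)]
      push_cast
      rw [mul_pow, mul_pow, div_pow, one_div_pow, pow_add]
      have hn : (0 : ℝ) < n := by exact_mod_cast hc.2
      have hm : (0 : ℝ) < m := by exact_mod_cast hc.2.trans hc.1
      field_simp
    · rw [if_neg hc, if_neg (by omega)]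
      simp
  · rintro ⟨m, n⟩ hp
    have hp' := Set.mem_of_indicator_ne_zero hp
    simp only [Set.mem_ofPred_eq] at hp'
    refine ⟨(m / 2, n / 2), ?_⟩
    simp only [Prod.mk.injEq]
    omega

theorem weighted_sum_formula_level2_zeta (k : ℕ) (hk : 3 ≤ k) :
    ∑ j ∈ Finset.Icc 2 (k - 1), (2 : ℝ) ^ j * levelTwoDoubleZeta 0 0 j (k - j)
      = (((k : ℝ) + 1) / 2 ^ (k - 2)) * singleZeta k := by
  obtain ⟨d, rfl⟩ : ∃ d, k = d + 2 := ⟨k - 2, by omega⟩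
  have hd : 1 ≤ d := by omega
  have hD := hasSum_diagonalPart (k := d + 2) (by omega)
  have hA := (summable_antisymmPart hd).hasSum
  have hT := (summable_telescopingPart hd).hasSum
  rw [tsum_antisymmPart hd] at hA
  rw [tsum_telescopingPart hd] at hT
  have hsum := ((hD.mul_left (d : ℝ)).add hA).add hT
  simp only [← sum_weightedSummand] at hsum
  have hs : ∀ j ∈ Finset.Icc 2 (d + 1), Summable (weightedSummand j (d + 2 - j)) := fun j hj =>
    Summable.of_nonneg_of_le (weightedSummand_nonneg _ _)
      (fun p => Finset.single_le_sum (f := fun j => weightedSummand j (d + 2 - j) p)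
        (fun i _ => weightedSummand_nonneg _ _ _) hj) hsum.summable
  have htotal := (Summable.tsum_finsetSum hs).symm.trans hsum.tsum_eq
  have hterm : ∀ j ∈ Finset.Icc 2 (d + 1), (2 : ℝ) ^ j * levelTwoDoubleZeta 0 0 j (d + 2 - j)
      = 4 / 2 ^ (d + 2) * ∑' p, weightedSummand j (d + 2 - j) p := by
    intro j hj
    have := Finset.mem_Icc.1 hj
    rw [tsum_weightedSummand, show j + (d + 2 - j) = d + 2 by omega]
  rw [show d + 2 - 1 = d + 1 by omega, Finset.sum_congr rfl hterm, ← Finset.mul_sum, htotal,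
    Nat.add_sub_cancel, pow_add]
  push_cast
  field_simp
  ring
end
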